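/- arXiv:2408.03067 — 2 statements merged into one kernel-verified Lean document; each statement's English description precedes it below -/
import Mathlib

section
/- Let n ≥ 2, s ∈ (0,1), γ₀ > −n, γ ∈ (−n, γ₀], and q > 2. Assume f : ℝⁿ → [0,∞) is measurable and satisfies: the mass bound m₀ ≤ ∫_{ℝⁿ} f(v) dv ≤ M₀; the pressure lower bound inf_{σ ∈ S^{n-1}} sup_{e ∈ S^{n-1}, e ⊥ σ} ∫_{ℝⁿ} f(v̄ + w) |w·e|² dw ≥ p₀ > 0, where v̄ := (∫_{ℝⁿ} f(v) v dv)/(∫_{ℝⁿ} f(v) dv); and the moment bound ∫_{ℝⁿ} f(v) |v|^q dv ≤ M_q. Then there exists λ > 0, depending only on n, m₀, M₀, p₀, M_q, q, and γ₀ (independent of s and of v₀), such that for every v₀ ∈ ℝⁿ, every r > 0, every v in the ball B₂ of radius 2 centered at the origin, and every e ∈ S^{n-1}: ∫_{B_r} K̃_f(v, v+h) · (max(h·e, 0))² dh ≥ λ r^{2−2s}, where K̃_f is the transformed normalized Boltzmann-type kernel associated to v₀. -/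
open MeasureTheory Metric Set
open scoped ENNReal RealInnerProductSpace NNReal

noncomputable section

/-- `ℝⁿ` -/
abbrev En (n : ℕ) := EuclideanSpace ℝ (Fin n)

/-- The mean velocity `v̄ = (∫ f v dv) / (∫ f dv)`. -/
def vbar {n : ℕ} (f : En n → ℝ) : En n := (∫ v, f v)⁻¹ • ∫ v, f v • v

/-- Mass bounds `m₀ ≤ ∫ f ≤ M₀`. -/
def MassBound {n : ℕ} (f : En n → ℝ) (m₀ M₀ : ℝ) : Prop :=
  ENNReal.ofReal m₀ ≤ (∫⁻ v, ENNReal.ofReal (f v)) ∧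
    (∫⁻ v, ENNReal.ofReal (f v)) ≤ ENNReal.ofReal M₀

/-- Pressure lower bound:
`inf_{σ ∈ S^{n-1}} sup_{e ∈ S^{n-1}, e ⊥ σ} ∫ f(v̄+w) |w·e|² dw ≥ p₀`,
written via the ε-characterization of the supremum. -/
def PressureLB {n : ℕ} (f : En n → ℝ) (p₀ : ℝ) : Prop :=
  ∀ σ : En n, ‖σ‖ = 1 → ∀ ε : ℝ, 0 < ε → ∃ e : En n, ‖e‖ = 1 ∧ ⟪e, σ⟫ = 0 ∧
    ENNReal.ofReal (p₀ - ε) ≤ ∫⁻ w, ENNReal.ofReal (f (vbar f + w) * ⟪w, e⟫ ^ 2)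

/-- Moment bound `∫ f(v) |v|^q dv ≤ M_q`. -/
def MomentBound {n : ℕ} (f : En n → ℝ) (q Mq : ℝ) : Prop :=
  (∫⁻ v, ENNReal.ofReal (f v * ‖v‖ ^ q)) ≤ ENNReal.ofReal Mq

/-- The normalized Boltzmann-type kernel
`K_f(v,v') = (1-s)|v'-v|^{-n-2s} ∫_{w ⊥ v'-v} f(v+w)|w|^{γ+2s+1} dw`,
with values in `[0,∞]`; the hyperplane integral is taken with respect to the
`(n-1)`-dimensional Hausdorff (i.e. Lebesgue) measure on the hyperplane through the origin
orthogonal to `v' - v`. -/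
def KfE (n : ℕ) (s γ : ℝ) (f : En n → ℝ) (v v' : En n) : ℝ≥0∞ :=
  ENNReal.ofReal ((1 - s) * ‖v' - v‖ ^ (-(n:ℝ) - 2*s)) *
    ∫⁻ w in {w : En n | ⟪w, v' - v⟫ = 0},
      ENNReal.ofReal (f (v + w) * ‖w‖ ^ (γ + 2*s + 1)) ∂μH[(n:ℝ) - 1]

/-- The change of variables `τ₀`: for `|v₀| ≥ 2` it maps `a v₀ + w ↦ (a/|v₀|) v₀ + w`
(for `w ⊥ v₀`); for `|v₀| < 2` it is the identity. -/
def tau0 {n : ℕ} (v₀ : En n) (u : En n) : En n :=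
  if 2 ≤ ‖v₀‖ then u + ((1 / ‖v₀‖ - 1) * (⟪u, v₀⟫ / ‖v₀‖ ^ 2)) • v₀ else u

/-- The inverse `τ₀⁻¹` of `τ₀`: for `|v₀| ≥ 2` it maps `a v₀ + w ↦ (a|v₀|) v₀/|v₀| ⋯`,
i.e. `a v₀ + w ↦ a‖v₀‖ v₀ + w` in the decomposition `u = a v₀ + w` with `w ⊥ v₀`;
for `|v₀| < 2` it is the identity. -/
def tau0inv {n : ℕ} (v₀ : En n) (u : En n) : En n :=
  if 2 ≤ ‖v₀‖ then u + ((‖v₀‖ - 1) * (⟪u, v₀⟫ / ‖v₀‖ ^ 2)) • v₀ else u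

/-- The transformed normalized Boltzmann-type kernel `K̃_f` associated with `v₀`:
`K̃_f(v,v') = |v₀|^{-1-γ-2s} K_f(v₀ + τ₀(v), v₀ + τ₀(v'))` if `|v₀| ≥ 2`, and
`K̃_f(v,v') = K_f(v₀ + v, v₀ + v')` if `|v₀| < 2`. -/
def KtildeE (n : ℕ) (s γ : ℝ) (f : En n → ℝ) (v₀ v v' : En n) : ℝ≥0∞ :=
  if 2 ≤ ‖v₀‖ then
    ENNReal.ofReal (‖v₀‖ ^ (-1 - γ - 2*s)) *
      KfE n s γ f (v₀ + tau0 v₀ v) (v₀ + tau0 v₀ v')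
  else KfE n s γ f (v₀ + v) (v₀ + v')

/-- The vector of `ℝ^{m+1}` with `i`-th coordinate `t` and remaining coordinates `y`. -/
def insertE {m : ℕ} (i : Fin (m + 1)) (t : ℝ) (y : Fin m → ℝ) : En (m + 1) :=
  WithLp.toLp 2 (Fin.insertNth (α := fun _ => ℝ) i t y)

@[simp] lemma insertE_same {m : ℕ} (i : Fin (m + 1)) (t : ℝ) (y : Fin m → ℝ) :
    insertE i t y i = t := by
  simp [insertE]

@[simp] lemma insertE_succAbove {m : ℕ} (i : Fin (m + 1)) (t : ℝ) (y : Fin m → ℝ) (k : Fin m) :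
    insertE i t y (i.succAbove k) = y k := by
  simp [insertE]

lemma insertE_eq {m : ℕ} (i : Fin (m + 1)) (w : En (m + 1)) :
    insertE i (w i) (fun k => w (i.succAbove k)) = w := by
  ext l
  rcases Fin.eq_self_or_eq_succAbove i l with rfl | ⟨k, rfl⟩ <;> simp

lemma measurable_insertE {m : ℕ} (i : Fin (m + 1)) :
    Measurable fun p : ℝ × (Fin m → ℝ) => insertE i p.1 p.2 := by
  refine (WithLp.measurable_toLp 2 _).comp (measurable_pi_lambda _ fun l => ?_)
  rcases Fin.eq_self_or_eq_succAbove i l with rfl | ⟨k, rfl⟩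
  · simpa using measurable_fst
  · simp only [Fin.insertNth_apply_succAbove]
    exact (measurable_pi_apply k).comp measurable_snd

lemma inner_eq_insert {m : ℕ} (i : Fin (m + 1)) (w h : En (m + 1)) :
    ⟪w, h⟫ = w i * h i + ∑ k, w (i.succAbove k) * h (i.succAbove k) := by
  rw [PiLp.inner_apply, Fin.sum_univ_succAbove _ i]
  simp [mul_comm]

/-- The vector orthogonal to `h` whose coordinates other than the `i`-th are `y`. -/
def perpE {m : ℕ} (i : Fin (m + 1)) (h : En (m + 1)) (y : Fin m → ℝ) : En (m + 1) :=
  insertE i (-(∑ k, y k * h (i.succAbove k)) / h i) y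

lemma inner_perpE {m : ℕ} (i : Fin (m + 1)) (h : En (m + 1)) (y : Fin m → ℝ) (hi : h i ≠ 0) :
    ⟪perpE i h y, h⟫ = 0 := by
  rw [inner_eq_insert i]
  simp [perpE, hi]

@[fun_prop]
lemma measurable_coordE {m : ℕ} (i : Fin m) : Measurable fun w : En m => w i :=
  (EuclideanSpace.proj (𝕜 := ℝ) i).continuous.measurable

lemma measurable_perpE {m : ℕ} (i : Fin (m + 1)) :
    Measurable fun p : En (m + 1) × (Fin m → ℝ) => perpE i p.1 p.2 := by
  refine (measurable_insertE i).comp (Measurable.prodMk ?_ measurable_snd)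
  refine Measurable.div (Measurable.neg (Finset.measurable_sum _ fun k _ => ?_))
    ((measurable_coordE i).comp measurable_fst)
  exact ((measurable_pi_apply k).comp measurable_snd).mul
    ((measurable_coordE _).comp measurable_fst)

lemma lintegral_insertE {m : ℕ} (j : Fin (m + 1)) {G : En (m + 1) → ℝ≥0∞} (hG : Measurable G) :
    ∫⁻ x, G x = ∫⁻ y : Fin m → ℝ, ∫⁻ t : ℝ, G (insertE j t y) := by
  rw [← (PiLp.volume_preserving_toLp (Fin (m + 1))).lintegral_comp hG,
    ← (volume_preserving_piFinSuccAbove (fun _ : Fin (m + 1) => ℝ) j).symm.lintegral_comp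
      (f := fun x => G (WithLp.toLp 2 x)) (hG.comp (WithLp.measurable_toLp 2 _))]
  exact lintegral_prod_symm' _ (hG.comp (measurable_insertE j))

/-- Integrating over a hyperplane dominates integrating over its graph parametrization, since
coordinate projections are `1`-Lipschitz. -/
lemma lintegral_perpE_le {m : ℕ} (i : Fin (m + 1)) (h : En (m + 1)) (hi : h i ≠ 0)
    {g : En (m + 1) → ℝ≥0∞} (hg : Measurable g) :
    ∫⁻ y : Fin m → ℝ, g (perpE i h y) ≤
      ∫⁻ w in {w : En (m + 1) | ⟪w, h⟫ = 0}, g w ∂μH[((m + 1 : ℕ) : ℝ) - 1] := by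
  set A : Set (En (m + 1)) := {w | ⟪w, h⟫ = 0}
  have hA : MeasurableSet A :=
    measurableSet_eq_fun (by fun_prop) measurable_const
  set Φ : En (m + 1) → (Fin m → ℝ) := fun w k => w (i.succAbove k)
  have hΦ : Measurable Φ := measurable_pi_lambda _ fun k => measurable_coordE _
  have hlip : LipschitzWith 1 Φ := by
    refine LipschitzWith.of_dist_le_mul fun x y => ?_
    rw [NNReal.coe_one, one_mul]
    refine (dist_pi_le_iff dist_nonneg).2 fun k => ?_
    rw [dist_eq_norm, dist_eq_norm]
    exact PiLp.norm_apply_le (x - y) (i.succAbove k)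
  have hΦp : ∀ y, Φ (perpE i h y) = y := fun y => by ext k; simp [Φ, perpE]
  have hpΦ : ∀ w ∈ A, perpE i h (Φ w) = w := by
    intro w hw
    have hw' : ⟪w, h⟫ = 0 := hw
    rw [inner_eq_insert i] at hw'
    conv_rhs => rw [← insertE_eq i w]
    simp only [perpE, Φ]
    congr 1
    field_simp
    linarith
  have hm : Measurable fun y => g (perpE i h y) :=
    hg.comp ((measurable_perpE i).comp (measurable_const.prodMk measurable_id))
  have hvol : (volume : Measure (Fin m → ℝ)) ≤
      (μH[((m + 1 : ℕ) : ℝ) - 1].restrict A).map Φ := by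
    refine Measure.le_iff.2 fun B hB => ?_
    rw [Measure.map_apply hΦ hB, Measure.restrict_apply (hΦ hB)]
    have himg : Φ '' (Φ ⁻¹' B ∩ A) = B := by
      ext y
      constructor
      · rintro ⟨w, hw, rfl⟩
        exact hw.1
      · intro hy
        exact ⟨perpE i h y, ⟨by simpa [hΦp] using hy, inner_perpE i h y hi⟩, hΦp y⟩
    have := hlip.hausdorffMeasure_image_le (d := m) (by positivity) (Φ ⁻¹' B ∩ A)
    rw [himg] at this
    have hpi := hausdorffMeasure_pi_real (ι := Fin m)
    rw [Fintype.card_fin] at hpi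
    rw [hpi] at this
    simpa using this
  calc ∫⁻ y, g (perpE i h y)
      ≤ ∫⁻ y, g (perpE i h y) ∂((μH[((m + 1 : ℕ) : ℝ) - 1].restrict A).map Φ) :=
        lintegral_mono' hvol le_rfl
    _ = ∫⁻ w in A, g (perpE i h (Φ w)) ∂μH[((m + 1 : ℕ) : ℝ) - 1] := lintegral_map hm hΦ
    _ = _ := setLIntegral_congr_fun hA fun w hw => by simp only [hpΦ w hw]

lemma lintegral_affine (α β : ℝ) (hα : α ≠ 0) {ψ : ℝ → ℝ≥0∞} (hψ : Measurable ψ) :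
    ∫⁻ t, ψ t = ENNReal.ofReal |α| * ∫⁻ s, ψ (α * s + β) := by
  rw [← lintegral_add_right_eq_self ψ β]
  conv_lhs => rw [← Real.smul_map_volume_mul_left hα]
  rw [lintegral_smul_measure, lintegral_map (by fun_prop) (by fun_prop), smul_eq_mul]

/-- The one-dimensional change of variables behind `lintegral_swap_perp`. -/
lemma lintegral_swap_perp_aux {m : ℕ} (i j : Fin (m + 1)) (i' j' : Fin m)
    (hi' : j.succAbove i' = i) (hj' : i.succAbove j' = j)
    {F : En (m + 1) → En (m + 1) → ℝ≥0∞} (hF : Measurable (Function.uncurry F))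
    (y y' : Fin m → ℝ) :
    ∫⁻ t, ENNReal.ofReal (|perpE j (insertE i t y') y i| / |insertE i t y' j|) *
        F (perpE j (insertE i t y') y) (insertE i t y') ≤
      ∫⁻ s, F (insertE j s y) (perpE i (insertE j s y) y') := by
  have hm : Measurable fun t : ℝ =>
      ENNReal.ofReal (|perpE j (insertE i t y') y i| / |insertE i t y' j|) *
        F (perpE j (insertE i t y') y) (insertE i t y') := by
    have h0 : Measurable fun t : ℝ => insertE i t y' :=
      (measurable_insertE i).comp (measurable_id.prodMk measurable_const)
    have h1 : Measurable fun t : ℝ => perpE j (insertE i t y') y :=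
      (measurable_perpE j).comp (h0.prodMk measurable_const)
    refine Measurable.mul (ENNReal.measurable_ofReal.comp ?_) (hF.comp (h1.prodMk h0))
    exact (measurable_norm.comp ((measurable_coordE i).comp h1)).div
      (measurable_norm.comp ((measurable_coordE j).comp h0))
  by_cases hy : y i' = 0
  · refine le_of_eq_of_le ?_ zero_le
    rw [lintegral_eq_zero_iff hm]
    refine Filter.Eventually.of_forall fun t => ?_
    have : perpE j (insertE i t y') y i = 0 := by
      rw [perpE, ← hi', insertE_succAbove, hy]
    simp [this]
  by_cases hw : y' j' = 0
  · refine le_of_eq_of_le ?_ zero_le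
    rw [lintegral_eq_zero_iff hm]
    refine Filter.Eventually.of_forall fun t => ?_
    have : insertE i t y' j = 0 := by rw [← hj', insertE_succAbove, hw]
    simp [this]
  have hα : -(y' j') / y i' ≠ 0 := div_ne_zero (neg_ne_zero.2 hw) hy
  set c : ℝ := ∑ k ∈ Finset.univ.erase j', y' k * insertE j 0 y (i.succAbove k)
  rw [lintegral_affine (-(y' j') / y i') (-c / y i') hα
    hm,
    ← lintegral_const_mul' _ _ ENNReal.ofReal_ne_top]
  refine lintegral_mono fun s => ?_
  have hsum : ∑ k, y' k * insertE j s y (i.succAbove k) = y' j' * s + c := by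
    rw [← Finset.add_sum_erase _ _ (Finset.mem_univ j'), hj', insertE_same]
    congr 1
    refine Finset.sum_congr rfl fun k hk => ?_
    have : i.succAbove k ≠ j := by
      rw [← hj']
      exact fun h => (Finset.ne_of_mem_erase hk) (Fin.succAbove_right_injective h)
    obtain ⟨l, hl⟩ := Fin.exists_succAbove_eq this
    rw [← hl]; simp
  have hi0 : insertE j s y i = y i' := by rw [← hi', insertE_succAbove]
  have hw1 : perpE i (insertE j s y) y' =
      insertE i (-(y' j') / y i' * s + -c / y i') y' := by
    rw [perpE, hsum, hi0]
    congr 1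
    ring
  have hh1 : perpE j (insertE i (-(y' j') / y i' * s + -c / y i') y') y = insertE j s y := by
    rw [← hw1]
    have h0 := inner_perpE i (insertE j s y) y' (by rw [hi0]; exact hy)
    have hj0 : perpE i (insertE j s y) y' j = y' j' := by
      rw [perpE, ← hj', insertE_succAbove]
    rw [real_inner_comm, inner_eq_insert j] at h0
    simp only [insertE_same, insertE_succAbove, hj0] at h0
    rw [perpE, hj0]
    congr 1
    field_simp
    linarith
  rw [hh1, hw1, hi0, ← mul_assoc, ← ENNReal.ofReal_mul (abs_nonneg _)]
  have hj0 : insertE i (-(y' j') / y i' * s + -c / y i') y' j = y' j' := by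
    rw [← hj', insertE_succAbove]
  rw [hj0]
  have : |-(y' j') / y i'| * (|y i'| / |y' j'|) = 1 := by
    rw [abs_div, abs_neg]
    have := abs_pos.2 hy
    have := abs_pos.2 hw
    field_simp
  rw [this]; simp

lemma lintegral_insertE_prod {m : ℕ} (i : Fin (m + 1))
    {L : En (m + 1) × (Fin m → ℝ) → ℝ≥0∞} (hL : Measurable L) :
    ∫⁻ w, ∫⁻ y : Fin m → ℝ, L (w, y) =
      ∫⁻ y' : Fin m → ℝ, ∫⁻ y : Fin m → ℝ, ∫⁻ t : ℝ, L (insertE i t y', y) := by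
  rw [lintegral_insertE i hL.lintegral_prod_right']
  refine lintegral_congr fun y' => lintegral_lintegral_swap (f := fun t y => L (insertE i t y', y)) ?_
  exact (hL.comp (((measurable_insertE i).comp (measurable_fst.prodMk measurable_const)).prodMk
    measurable_snd)).aemeasurable

lemma lintegral_insertE_prod_swap {m : ℕ} (i : Fin (m + 1))
    {L : En (m + 1) × (Fin m → ℝ) → ℝ≥0∞} (hL : Measurable L) :
    ∫⁻ w, ∫⁻ y : Fin m → ℝ, L (w, y) =
      ∫⁻ y : Fin m → ℝ, ∫⁻ y' : Fin m → ℝ, ∫⁻ t : ℝ, L (insertE i t y', y) := by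
  rw [lintegral_insertE_prod i hL]
  refine lintegral_lintegral_swap (f := fun y' y => ∫⁻ t : ℝ, L (insertE i t y', y)) ?_
  have h : Measurable fun q : ((Fin m → ℝ) × (Fin m → ℝ)) × ℝ => L (insertE i q.2 q.1.1, q.1.2) :=
    hL.comp (((measurable_insertE i).comp (measurable_snd.prodMk
      (measurable_fst.comp measurable_fst))).prodMk (measurable_snd.comp measurable_fst))
  exact h.lintegral_prod_right'.aemeasurable

/-- Exchange of the roles of `h` and `w` in integrals over pairs of orthogonal vectors. -/
lemma lintegral_swap_perp {m : ℕ} (i j : Fin (m + 1)) (hij : i ≠ j)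
    {F : En (m + 1) → En (m + 1) → ℝ≥0∞} (hF : Measurable (Function.uncurry F)) :
    ∫⁻ w, ∫⁻ y : Fin m → ℝ, ENNReal.ofReal (|perpE j w y i| / |w j|) * F (perpE j w y) w ≤
      ∫⁻ h, ∫⁻ y : Fin m → ℝ, F h (perpE i h y) := by
  have hL : Measurable fun p : En (m + 1) × (Fin m → ℝ) =>
      ENNReal.ofReal (|perpE j p.1 p.2 i| / |p.1 j|) * F (perpE j p.1 p.2) p.1 := by
    have h1 := measurable_perpE j
    refine Measurable.mul (ENNReal.measurable_ofReal.comp ?_) ?_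
    · have h2 : Measurable fun p : En (m + 1) × (Fin m → ℝ) => perpE j p.1 p.2 i :=
        (measurable_coordE i).comp h1
      have h3 : Measurable fun p : En (m + 1) × (Fin m → ℝ) => p.1 j :=
        (measurable_coordE j).comp measurable_fst
      exact (measurable_norm.comp h2).div (measurable_norm.comp h3)
    · exact hF.comp (h1.prodMk measurable_fst)
  have hR : Measurable fun p : En (m + 1) × (Fin m → ℝ) => F p.1 (perpE i p.1 p.2) :=
    hF.comp (measurable_fst.prodMk (measurable_perpE i))
  obtain ⟨i', hi'⟩ : ∃ k, j.succAbove k = i := Fin.exists_succAbove_eq hij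
  obtain ⟨j', hj'⟩ : ∃ k, i.succAbove k = j := Fin.exists_succAbove_eq hij.symm
  refine (lintegral_insertE_prod_swap i hL).trans_le
    (le_of_le_of_eq ?_ (lintegral_insertE_prod j hR).symm)
  exact lintegral_mono fun y => lintegral_mono fun y' =>
    lintegral_swap_perp_aux i j i' j' hi' hj' hF y y'

lemma norm_le_sum_abs {m : ℕ} (x : En m) : ‖x‖ ≤ ∑ k, |x k| := by
  conv_lhs => rw [← (EuclideanSpace.basisFun (Fin m) ℝ).sum_repr x]
  refine (norm_sum_le _ _).trans (Finset.sum_le_sum fun k _ => ?_)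
  simp [norm_smul]

lemma abs_coordE_le {m : ℕ} (x : En m) (k : Fin m) : |x k| ≤ ‖x‖ := by
  simpa using PiLp.norm_apply_le x k

lemma inner_perpE_left {m : ℕ} (j : Fin (m + 1)) (w u : En (m + 1))
    (y : Fin m → ℝ) :
    ⟪perpE j w y, u⟫ = ∑ k, y k * (u - (u j / w j) • w) (j.succAbove k) := by
  rw [inner_eq_insert j]
  simp only [perpE, insertE_same, insertE_succAbove, PiLp.sub_apply, PiLp.smul_apply, smul_eq_mul,
    mul_sub, Finset.sum_sub_distrib]
  have : ∑ k, y k * (u j / w j * w (j.succAbove k)) =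
      (∑ k, y k * w (j.succAbove k)) * u j / w j := by
    rw [Finset.sum_mul, Finset.sum_div]
    exact Finset.sum_congr rfl fun k _ => by ring
  rw [this]; ring

lemma norm_perpE_le {m : ℕ} (j : Fin (m + 1)) (w : En (m + 1)) (hw : w ≠ 0)
    (hj : ‖w‖ ≤ (m + 1) * |w j|) (y : Fin m → ℝ) {a : ℝ} (hy : ∀ k, |y k| ≤ a) :
    ‖perpE j w y‖ ≤ m * (m + 2) * a := by
  have hw0 : 0 < ‖w‖ := norm_pos_iff.2 hw
  have hj0 : 0 < |w j| := by
    by_contra h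
    nlinarith [abs_nonneg (w j), (Nat.cast_nonneg m : (0:ℝ) ≤ m)]
  refine (norm_le_sum_abs _).trans ?_
  rw [Fin.sum_univ_succAbove _ j]
  simp only [perpE, insertE_same, insertE_succAbove]
  have h1 : ∑ k, |y k| ≤ m * a := by
    refine (Finset.sum_le_sum fun k _ => hy k).trans ?_
    simp
  have h2 : |-(∑ k, y k * w (j.succAbove k)) / w j| ≤ m * a * (m + 1) := by
    rw [abs_div, abs_neg, div_le_iff₀ hj0]
    refine (Finset.abs_sum_le_sum_abs _ _).trans ?_
    calc ∑ k, |y k * w (j.succAbove k)| ≤ ∑ k, |y k| * ‖w‖ :=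
          Finset.sum_le_sum fun k _ => by
            rw [abs_mul]; gcongr; exact abs_coordE_le _ _
      _ = (∑ k, |y k|) * ‖w‖ := by rw [Finset.sum_mul]
      _ ≤ m * a * ((m + 1) * |w j|) :=
          mul_le_mul h1 hj (norm_nonneg _) ((Finset.sum_nonneg fun k _ => abs_nonneg _).trans h1)
      _ = _ := by ring
  linarith

/-- In every hyperplane direction there is a box of `y`'s on which the vectors `perpE j w y` have
comparable size, a large `i`-th coordinate and a large component along `u`. -/
lemma box_bounds {m : ℕ} (i j : Fin (m + 1)) (i' : Fin m) (hi' : j.succAbove i' = i)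
    (w u : En (m + 1)) (hw : w ≠ 0) (hj : ‖w‖ ≤ (m + 1) * |w j|) {d : ℝ} (hd : 0 < d)
    (hu : ∀ t : ℝ, d ≤ ‖u - t • w‖) {a : ℝ} (ha : 0 < a) :
    ∃ z : Fin m → ℝ, ∀ y ∈ ball z (a / (2 * (m + 1))),
      a / 2 ≤ |perpE j w y i| ∧ ‖perpE j w y‖ ≤ 3 * (m + 2) ^ 2 * a ∧
        a * d / 2 ≤ ⟪perpE j w y, u⟫ := by
  have hw0 : 0 < ‖w‖ := norm_pos_iff.2 hw
  have hj0 : w j ≠ 0 := by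
    intro h
    rw [h] at hj
    simp at hj
    exact hw hj
  set P : En (m + 1) := u - (u j / w j) • w
  have hP : d ≤ ‖P‖ := hu _
  have hP0 : 0 < ‖P‖ := hd.trans_le hP
  have hPj : P j = 0 := by simp [P, hj0]
  obtain ⟨t, ht, htP⟩ : ∃ t : ℝ, |t| = 1 ∧ t * P i = |P i| := by
    rcases le_total 0 (P i) with h | h
    · exact ⟨1, by simp, by rw [abs_of_nonneg h, one_mul]⟩
    · exact ⟨-1, by simp, by rw [abs_of_nonpos h]; ring⟩
  set b : ℝ := a / (2 * (m + 1)) with hb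
  have hm : (0:ℝ) ≤ m := Nat.cast_nonneg m
  have hb0 : 0 < b := by positivity
  have hb1 : b * m ≤ a / 2 := by
    rw [hb, div_mul_eq_mul_div, div_le_div_iff₀ (by positivity) (by positivity)]
    nlinarith
  have hb2 : b ≤ a / 2 := by
    rw [hb]; gcongr; linarith
  set q : Fin m → ℝ := fun k => P (j.succAbove k) / ‖P‖ + if k = i' then t else 0
  have hq1 : ∀ k, |q k| ≤ 2 := fun k => by
    refine (abs_add_le _ _).trans ?_
    have h1 : |P (j.succAbove k) / ‖P‖| ≤ 1 := by
      rw [abs_div, abs_norm, div_le_one hP0]; exact abs_coordE_le _ _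
    have h2 : |if k = i' then t else 0| ≤ 1 := by
      split_ifs <;> simp [ht]
    linarith
  have hq2 : 1 ≤ |q i'| := by
    have h : t * q i' = |P i| / ‖P‖ + 1 := by
      simp only [q, if_true, hi', mul_add, ← mul_div_assoc, htP]
      rw [← abs_mul_abs_self t, ht, one_mul]
    calc (1:ℝ) ≤ t * q i' := by rw [h]; have := div_nonneg (abs_nonneg (P i)) hP0.le; linarith
      _ ≤ |t * q i'| := le_abs_self _
      _ = |q i'| := by rw [abs_mul, ht, one_mul]
  have hq3 : ‖P‖ ≤ ∑ k, q k * P (j.succAbove k) := by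
    have h1 : ∑ k, P (j.succAbove k) * P (j.succAbove k) = ‖P‖ ^ 2 := by
      rw [← real_inner_self_eq_norm_sq, inner_eq_insert j, hPj]; simp
    have h2 : ∑ k, q k * P (j.succAbove k) = ‖P‖ + |P i| := by
      simp only [q, add_mul, Finset.sum_add_distrib, ite_mul, zero_mul, Finset.sum_ite_eq',
        Finset.mem_univ, if_true, hi', htP]
      congr 1
      have : ∀ k, P (j.succAbove k) / ‖P‖ * P (j.succAbove k) =
        (P (j.succAbove k) * P (j.succAbove k)) / ‖P‖ := fun k => by ring
      rw [Finset.sum_congr rfl fun k _ => this k, ← Finset.sum_div, h1]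
      field_simp
    rw [h2]; have := abs_nonneg (P i); linarith
  refine ⟨a • q, fun y hy => ?_⟩
  have hyk : ∀ k, |y k - a * q k| ≤ b := fun k => by
    have h := (dist_pi_lt_iff hb0).1 (mem_ball.1 hy) k
    rw [Real.dist_eq] at h
    exact h.le
  refine ⟨?_, ?_, ?_⟩
  · have h1 : perpE j w y i = y i' := by rw [← hi', perpE, insertE_succAbove]
    rw [h1]
    have h2 := abs_sub_abs_le_abs_sub (a * q i') (y i')
    rw [abs_sub_comm, abs_mul, abs_of_pos ha] at h2
    nlinarith [hyk i']
  · have h1 : ∀ k, |y k| ≤ 3 * a := fun k => by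
      have h2 := abs_sub_abs_le_abs_sub (y k) (a * q k)
      rw [abs_mul, abs_of_pos ha] at h2
      nlinarith [hyk k, hq1 k]
    refine (norm_perpE_le j w hw hj y h1).trans ?_
    have : (m:ℝ) * (m + 2) ≤ (m + 2) ^ 2 := by nlinarith
    nlinarith
  · rw [inner_perpE_left j w u]
    have h1 : ∑ k, y k * P (j.succAbove k) = a * ∑ k, q k * P (j.succAbove k) +
        ∑ k, (y k - a * q k) * P (j.succAbove k) := by
      rw [Finset.mul_sum, ← Finset.sum_add_distrib]
      exact Finset.sum_congr rfl fun k _ => by ring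
    have h2 : |∑ k, (y k - a * q k) * P (j.succAbove k)| ≤ m * (b * ‖P‖) := by
      refine (Finset.abs_sum_le_sum_abs _ _).trans ?_
      refine (Finset.sum_le_sum (g := fun _ => b * ‖P‖) fun k _ => ?_).trans (by simp)
      rw [abs_mul]
      exact mul_le_mul (hyk k) (abs_coordE_le _ _) (abs_nonneg _) hb0.le
    change _ ≤ ∑ k, y k * P (j.succAbove k)
    rw [h1]
    have h3 := (abs_le.1 h2).1
    have h4 : a * ‖P‖ ≤ a * ∑ k, q k * P (j.succAbove k) := by gcongr
    have h5 : m * (b * ‖P‖) ≤ a / 2 * ‖P‖ := by nlinarith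
    have h6 : a * d / 2 ≤ a / 2 * ‖P‖ := by nlinarith
    linarith

/-- Lower bound for the integral over the directions `h ⊥ w`, localized to one annulus. -/
lemma exists_inner_lower (m : ℕ) {R : ℝ} (hR : 1 ≤ R) :
    ∃ κ c : ℝ, 0 < κ ∧ κ < 1 ∧ 0 < c ∧
      ∀ (s ρ : ℝ) (S : En (m + 1) → En (m + 1)) (i j : Fin (m + 1)) (w u : En (m + 1)) (d : ℝ),
        0 < s → 0 < ρ → i ≠ j → w ≠ 0 → ‖w‖ ≤ (m + 1) * |w j| → 0 < d →
        (∀ t : ℝ, d ≤ ‖u - t • w‖) →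
        (∀ h, ⟪h, w⟫ = 0 → ‖h‖ ≤ ‖S h‖ ∧ ‖S h‖ ≤ R * ‖h‖) →
        ENNReal.ofReal (c * d ^ 2 * ρ ^ (2 - 2 * s) / ‖w‖) ≤
          ∫⁻ y : Fin m → ℝ, ENNReal.ofReal (|perpE j w y i| / |w j|) *
            ({h | κ * ρ ≤ ‖S h‖ ∧ ‖S h‖ < ρ}.indicator (fun h =>
              ENNReal.ofReal (‖h‖ ^ (-((m + 1 : ℕ) : ℝ) - 2 * s) * max ⟪h, u⟫ 0 ^ 2))
                (perpE j w y)) := by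
  set α : ℝ := 1 / (6 * (m + 2) ^ 2 * R) with hα
  have hR0 : 0 < R := by linarith
  have hm : (0:ℝ) ≤ m := Nat.cast_nonneg m
  have hα0 : 0 < α := by positivity
  have hα1 : α ≤ 1 := by
    rw [hα, div_le_one (by positivity)]
    nlinarith
  refine ⟨α / 2, (α / 2) ^ 3 * (α / (m + 1)) ^ m, by positivity, by linarith, by positivity, ?_⟩
  intro s ρ S i j w u d hs hρ hij hw hj hd hu hS
  obtain ⟨i', hi'⟩ : ∃ k, j.succAbove k = i := Fin.exists_succAbove_eq hij
  have hw0 : 0 < ‖w‖ := norm_pos_iff.2 hw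
  have hj0 : w j ≠ 0 := by
    intro h
    rw [h] at hj
    simp at hj
    exact hw hj
  obtain ⟨z, hz⟩ := box_bounds i j i' hi' w u hw hj hd hu (mul_pos hα0 hρ)
  have hr : 0 < α * ρ / (2 * (m + 1)) := by positivity
  calc ENNReal.ofReal ((α / 2) ^ 3 * (α / (m + 1)) ^ m * d ^ 2 * ρ ^ (2 - 2 * s) / ‖w‖)
      = ENNReal.ofReal ((α * ρ / 2) / ‖w‖ *
          (ρ ^ (-((m + 1 : ℕ) : ℝ) - 2 * s) * (α * ρ * d / 2) ^ 2)) *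
          volume (ball z (α * ρ / (2 * (m + 1)))) := by
        rw [Real.volume_pi_ball _ hr, ← ENNReal.ofReal_mul (by positivity), Fintype.card_fin]
        congr 1
        have h1 : ρ ^ (2 - 2 * s) =
            ρ ^ (-((m + 1 : ℕ) : ℝ) - 2 * s) * (ρ ^ 3 * ρ ^ m) := by
          rw [← pow_add, ← Real.rpow_natCast ρ, ← Real.rpow_add hρ]
          congr 1; push_cast; ring
        rw [h1]
        have h2 : 2 * (α * ρ / (2 * ((m:ℝ) + 1))) = α / (m + 1) * ρ := by
          field_simp
        rw [h2, mul_pow]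
        ring
    _ = ∫⁻ y in ball z (α * ρ / (2 * (m + 1))), ENNReal.ofReal ((α * ρ / 2) / ‖w‖ *
          (ρ ^ (-((m + 1 : ℕ) : ℝ) - 2 * s) * (α * ρ * d / 2) ^ 2)) := by
        rw [setLIntegral_const]
    _ ≤ ∫⁻ y in ball z (α * ρ / (2 * (m + 1))), ENNReal.ofReal (|perpE j w y i| / |w j|) *
            ({h | α / 2 * ρ ≤ ‖S h‖ ∧ ‖S h‖ < ρ}.indicator (fun h =>
              ENNReal.ofReal (‖h‖ ^ (-((m + 1 : ℕ) : ℝ) - 2 * s) * max ⟪h, u⟫ 0 ^ 2))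
                (perpE j w y)) := by
        refine setLIntegral_mono' measurableSet_ball fun y hy => ?_
        obtain ⟨h1, h2, h3⟩ := hz y hy
        set H := perpE j w y
        have hH1 : α * ρ / 2 ≤ ‖H‖ := h1.trans (abs_coordE_le _ _)
        have hH2 : R * ‖H‖ ≤ ρ / 2 := by
          calc R * ‖H‖ ≤ R * (3 * (m + 2) ^ 2 * (α * ρ)) := by gcongr
            _ = ρ / 2 := by rw [hα]; field_simp; norm_num
        have hHρ : ‖H‖ ≤ ρ := by nlinarith [norm_nonneg H]
        have hH0 : 0 < ‖H‖ := lt_of_lt_of_le (by positivity) hH1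
        obtain ⟨hS1, hS2⟩ := hS H (inner_perpE j w y hj0)
        have hmem : H ∈ {h | α / 2 * ρ ≤ ‖S h‖ ∧ ‖S h‖ < ρ} :=
          ⟨by linarith, by linarith⟩
        rw [indicator_of_mem hmem, ← ENNReal.ofReal_mul (by positivity)]
        refine ENNReal.ofReal_le_ofReal ?_
        have e1 : α * ρ / 2 / ‖w‖ ≤ |H i| / |w j| := by
          have := abs_pos.2 hj0
          have := abs_coordE_le w j
          gcongr
        have e2 : ρ ^ (-((m + 1 : ℕ) : ℝ) - 2 * s) ≤ ‖H‖ ^ (-((m + 1 : ℕ) : ℝ) - 2 * s) :=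
          Real.rpow_le_rpow_of_nonpos hH0 hHρ (by
            have : (0:ℝ) ≤ ((m + 1 : ℕ) : ℝ) := Nat.cast_nonneg _
            linarith)
        have e3 : α * ρ * d / 2 ≤ max ⟪H, u⟫ 0 := h3.trans (le_max_left _ _)
        gcongr
    _ ≤ _ := setLIntegral_le_lintegral _ _

/-- A finite measure with second moment not carried by the hyperplane through its mean orthogonal
to `e` charges the complement of a slab around every hyperplane orthogonal to `e`. -/
lemma measure_off_slab {n : ℕ} (ν : Measure (En n)) [IsFiniteMeasure ν]
    {q R δ m₀ M₀ p₀ Mq : ℝ} (hq : 2 < q) (hR : 1 ≤ R) (hδ : 0 < δ) (hδ1 : δ ≤ 1)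
    (hm₀ : 0 < m₀) (hm : m₀ ≤ ν.real univ) (hM : ν.real univ ≤ M₀)
    (hint : Integrable (fun y => ‖y‖ ^ q) ν) (hmom : ∫ y, ‖y‖ ^ q ∂ν ≤ Mq)
    {e : En n} (he : ‖e‖ = 1)
    (hp : p₀ / 2 ≤ ∫ y, ⟪y - (ν.real univ)⁻¹ • ∫ y, y ∂ν, e⟫ ^ 2 ∂ν)
    (hδp : δ ^ 2 * M₀ ≤ p₀ / 8) (hRp : 9 * R ^ (2 - q) * Mq ≤ p₀ / 8)
    (hRm : 9 * R ^ (2 - q) * Mq ≤ m₀ / 2) (a : ℝ) :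
    min (p₀ / (36 * R ^ 2)) (m₀ / 2) ≤ ν.real {y | ‖y‖ ≤ R ∧ δ ≤ |⟪y, e⟫ - a|} := by
  have hR0 : 0 < R := by linarith
  set B : Set (En n) := {y | ‖y‖ ≤ R ∧ δ ≤ |⟪y, e⟫ - a|} with hB
  have hBm : MeasurableSet B := by
    have h : Measurable fun y : En n => |⟪y, e⟫ - a| := by fun_prop
    exact (measurableSet_le measurable_norm measurable_const).inter
      (measurableSet_le measurable_const h)
  have hY : ∀ y : En n, |⟪y, e⟫| ≤ ‖y‖ := fun y => by
    simpa [he] using abs_real_inner_le_norm y e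
  have hpow : ∀ y : En n, ‖y‖ ^ 2 ≤ 1 + ‖y‖ ^ q := fun y => by
    rcases le_total ‖y‖ 1 with h | h
    · have := Real.rpow_nonneg (norm_nonneg y) q
      nlinarith [norm_nonneg y]
    · have := Real.rpow_le_rpow_of_exponent_le h hq.le
      rw [Real.rpow_two] at this
      linarith
  have hsq : Integrable (fun y => ‖y‖ ^ 2) ν :=
    ((integrable_const 1).add hint).mono' (by fun_prop) (Filter.Eventually.of_forall fun y => by
      simpa using hpow y)
  have hid : Integrable (fun y : En n => y) ν :=
    ((integrable_const 1).add hsq).mono' (by fun_prop) (Filter.Eventually.of_forall fun y => by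
      simp only [Pi.add_apply]
      nlinarith [sq_nonneg (‖y‖ - 1)])
  have hYi : Integrable (fun y : En n => ⟪y, e⟫) ν := hid.inner_const e
  have hY2 : Integrable (fun y : En n => ⟪y, e⟫ ^ 2) ν :=
    hsq.mono' (by fun_prop) (Filter.Eventually.of_forall fun y => by
      rw [Real.norm_eq_abs, abs_pow]
      exact pow_le_pow_left₀ (abs_nonneg _) (hY y) 2)
  have hmean : ∫ y, ⟪y, e⟫ ∂ν =
      ν.real univ * ⟪(ν.real univ)⁻¹ • ∫ y, y ∂ν, e⟫ := by
    have h1 : ∫ y, ⟪y, e⟫ ∂ν = ⟪∫ y, y ∂ν, e⟫ := by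
      rw [real_inner_comm, ← integral_inner hid e]
      exact integral_congr_ae (Filter.Eventually.of_forall fun y => real_inner_comm _ _)
    have h2 : ν.real univ ≠ 0 := by linarith
    rw [h1, inner_smul_left]
    simp [h2]
  set b : ℝ := ⟪(ν.real univ)⁻¹ • ∫ y, y ∂ν, e⟫
  have hvar : ∀ c : ℝ, ∫ y, (⟪y, e⟫ - c) ^ 2 ∂ν =
      ∫ y, ⟪y, e⟫ ^ 2 ∂ν - 2 * c * (ν.real univ * b) + c ^ 2 * ν.real univ := fun c => by
    have : ∀ y : En n, (⟪y, e⟫ - c) ^ 2 = ⟪y, e⟫ ^ 2 - 2 * c * ⟪y, e⟫ + c ^ 2 := fun y => by ring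
    simp_rw [this]
    have hd : Integrable (fun y : En n => ⟪y, e⟫ ^ 2 - 2 * c * ⟪y, e⟫) ν :=
      hY2.sub (hYi.const_mul _)
    rw [integral_add hd (integrable_const _),
      integral_sub hY2 (hYi.const_mul _), integral_const_mul, hmean, integral_const]
    simp [mul_comm]
  have hp' : p₀ / 2 ≤ ∫ y, (⟪y, e⟫ - a) ^ 2 ∂ν := by
    simp_rw [inner_sub_left] at hp
    have h1 := hvar b
    have h2 := hvar a
    have h3 : 0 ≤ ν.real univ * (a - b) ^ 2 := by positivity
    nlinarith
  have hnn : ∀ y : En n, 0 ≤ ‖y‖ ^ q := fun y => Real.rpow_nonneg (norm_nonneg y) q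
  have htail : ∀ y : En n, R < ‖y‖ → ‖y‖ ^ 2 ≤ R ^ (2 - q) * ‖y‖ ^ q := fun y hy => by
    have hy0 : 0 < ‖y‖ := hR0.trans hy
    calc ‖y‖ ^ 2 = ‖y‖ ^ (2 - q) * ‖y‖ ^ q := by
          rw [← Real.rpow_add hy0, ← Real.rpow_two]; congr 1; ring
      _ ≤ _ := by
          have := Real.rpow_le_rpow_of_nonpos hR0 hy.le (by linarith : 2 - q ≤ 0)
          have := hnn y
          gcongr
  have hBi : Integrable (B.indicator fun _ => (1:ℝ)) ν := (integrable_const 1).indicator hBm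
  have hBint : ∫ y, B.indicator (fun _ => (1:ℝ)) y ∂ν = ν.real B := by
    rw [integral_indicator hBm]; simp
  have hRq : 0 ≤ R ^ (2 - q) := Real.rpow_nonneg hR0.le _
  rcases le_or_gt |a| (2 * R) with ha | ha
  · refine (min_le_left _ _).trans ?_
    have hpt : ∀ y : En n, (⟪y, e⟫ - a) ^ 2 ≤
        δ ^ 2 + 9 * R ^ 2 * B.indicator (fun _ => (1:ℝ)) y + 9 * R ^ (2 - q) * ‖y‖ ^ q := by
      intro y
      have habs : |⟪y, e⟫ - a| ≤ ‖y‖ + 2 * R := (abs_sub _ _).trans (add_le_add (hY y) ha)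
      have hn := mul_nonneg hRq (hnn y)
      rw [← sq_abs (⟪y, e⟫ - a)]
      by_cases hyR : ‖y‖ ≤ R
      · by_cases hyB : δ ≤ |⟪y, e⟫ - a|
        · have hmem : y ∈ B := ⟨hyR, hyB⟩
          rw [indicator_of_mem hmem]
          have : |⟪y, e⟫ - a| ≤ 3 * R := by linarith
          nlinarith [pow_le_pow_left₀ (abs_nonneg _) this 2, sq_nonneg δ]
        · have hmem : y ∉ B := fun h => hyB h.2
          rw [indicator_of_notMem hmem]
          nlinarith [pow_le_pow_left₀ (abs_nonneg _) (not_le.1 hyB).le 2]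
      · have hmem : y ∉ B := fun h => hyR h.1
        rw [indicator_of_notMem hmem]
        have h1 : |⟪y, e⟫ - a| ≤ 3 * ‖y‖ := by linarith [not_le.1 hyR]
        nlinarith [pow_le_pow_left₀ (abs_nonneg _) h1 2, sq_nonneg δ, htail y (not_le.1 hyR)]
    have hI : ∫ y, (⟪y, e⟫ - a) ^ 2 ∂ν ≤
        δ ^ 2 * ν.real univ + 9 * R ^ 2 * ν.real B + 9 * R ^ (2 - q) * ∫ y, ‖y‖ ^ q ∂ν := by
      have h1 : Integrable (fun y : En n => (⟪y, e⟫ - a) ^ 2) ν := by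
        have : ∀ y : En n, (⟪y, e⟫ - a) ^ 2 = ⟪y, e⟫ ^ 2 - 2 * a * ⟪y, e⟫ + a ^ 2 :=
          fun y => by ring
        simp_rw [this]
        exact (hY2.sub (hYi.const_mul _)).add (integrable_const _)
      have h2 : Integrable (fun y : En n => δ ^ 2 + 9 * R ^ 2 * B.indicator (fun _ => (1:ℝ)) y) ν :=
        (integrable_const _).add (hBi.const_mul _)
      refine (integral_mono h1 (h2.add (hint.const_mul _)) hpt).trans (le_of_eq ?_)
      simp only [Pi.add_apply]
      rw [integral_add h2 (hint.const_mul _), integral_add (integrable_const _) (hBi.const_mul _),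
        integral_const_mul, integral_const_mul, hBint, integral_const]
      simp [mul_comm]
    have h3 : 9 * R ^ (2 - q) * ∫ y, ‖y‖ ^ q ∂ν ≤ 9 * R ^ (2 - q) * Mq := by gcongr
    have h4 : δ ^ 2 * ν.real univ ≤ δ ^ 2 * M₀ := by gcongr
    rw [div_le_iff₀ (by positivity)]
    linarith
  · refine (min_le_right _ _).trans ?_
    have hpt : ∀ y : En n, 1 ≤ B.indicator (fun _ => (1:ℝ)) y + R ^ (2 - q) * ‖y‖ ^ q := by
      intro y
      have hn := mul_nonneg hRq (hnn y)
      by_cases hyR : ‖y‖ ≤ R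
      · have hmem : y ∈ B := by
          refine ⟨hyR, ?_⟩
          have := abs_sub_abs_le_abs_sub a ⟪y, e⟫
          rw [abs_sub_comm] at this
          linarith [hY y]
        rw [indicator_of_mem hmem]
        linarith
      · have hmem : y ∉ B := fun h => hyR h.1
        rw [indicator_of_notMem hmem]
        nlinarith [htail y (not_le.1 hyR)]
    have hI : ν.real univ ≤ ν.real B + R ^ (2 - q) * ∫ y, ‖y‖ ^ q ∂ν := by
      have := integral_mono (integrable_const (1:ℝ)) (hBi.add (hint.const_mul _)) hpt
      simp only [Pi.add_apply] at this
      rw [integral_add hBi (hint.const_mul _), integral_const_mul, hBint, integral_const] at this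
      simpa using this
    have h3 : R ^ (2 - q) * ∫ y, ‖y‖ ^ q ∂ν ≤ R ^ (2 - q) * Mq := by gcongr
    have h4 : 0 ≤ R ^ (2 - q) * ∫ y, ‖y‖ ^ q ∂ν :=
      mul_nonneg hRq (integral_nonneg hnn)
    linarith

lemma exists_mass_off_slab (n : ℕ) (m₀ M₀ p₀ Mq q : ℝ) (hm₀ : 0 < m₀) (hp₀ : 0 < p₀)
    (hq : 2 < q) :
    ∃ R δ μ : ℝ, 1 ≤ R ∧ 0 < δ ∧ δ ≤ 1 ∧ 0 < μ ∧
      ∀ f : En n → ℝ, Measurable f → (∀ v, 0 ≤ f v) →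
        MassBound f m₀ M₀ → PressureLB f p₀ → MomentBound f q Mq →
        ∀ σ : En n, ‖σ‖ = 1 → ∃ e : En n, ‖e‖ = 1 ∧ ⟪e, σ⟫ = 0 ∧ ∀ a : ℝ,
          ENNReal.ofReal μ ≤
            ∫⁻ y in {y | ‖y‖ ≤ R ∧ δ ≤ |⟪y, e⟫ - a|}, ENNReal.ofReal (f y) := by
  set M : ℝ := max M₀ 1
  set K : ℝ := max Mq 1
  have hM : 0 < M := lt_max_of_lt_right one_pos
  have hK : 0 < K := lt_max_of_lt_right one_pos
  obtain ⟨R, hR1, hRp, hRm⟩ : ∃ R : ℝ, 1 ≤ R ∧ 9 * R ^ (2 - q) * K ≤ p₀ / 8 ∧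
      9 * R ^ (2 - q) * K ≤ m₀ / 2 := by
    have h : Filter.Tendsto (fun R : ℝ => 9 * R ^ (2 - q) * K) Filter.atTop (nhds 0) := by
      have := ((tendsto_rpow_neg_atTop (by linarith : 0 < q - 2)).const_mul 9).mul_const K
      simpa using this
    obtain ⟨R, h1, h2, h3⟩ := ((Filter.eventually_ge_atTop (1:ℝ)).and
      ((h.eventually_le_const (by positivity : 0 < p₀ / 8)).and
        (h.eventually_le_const (by positivity : 0 < m₀ / 2)))).exists
    exact ⟨R, h1, h2, h3⟩
  obtain ⟨δ, hδ0, hδ1, hδp⟩ : ∃ δ : ℝ, 0 < δ ∧ δ ≤ 1 ∧ δ ^ 2 * M ≤ p₀ / 8 := by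
    refine ⟨min 1 (p₀ / 8 / M), by positivity, min_le_left _ _, ?_⟩
    have h1 : min 1 (p₀ / 8 / M) ≤ 1 := min_le_left _ _
    have h2 : min 1 (p₀ / 8 / M) ≤ p₀ / 8 / M := min_le_right _ _
    have h3 : 0 < min 1 (p₀ / 8 / M) := by positivity
    calc min 1 (p₀ / 8 / M) ^ 2 * M ≤ (p₀ / 8 / M) * M := by
          gcongr
          nlinarith
      _ = p₀ / 8 := by field_simp
  have hR0 : 0 < R := by linarith
  refine ⟨R, δ, min (p₀ / (36 * R ^ 2)) (m₀ / 2), hR1, hδ0, hδ1, by positivity, ?_⟩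
  intro f hf hf0 hmass hpress hmom σ hσ
  obtain ⟨e, he, heσ, hpe⟩ := hpress σ hσ (p₀ / 2) (by positivity)
  refine ⟨e, he, heσ, fun a => ?_⟩
  have hfm : Measurable fun y => ENNReal.ofReal (f y) := by fun_prop
  set ν : Measure (En n) := volume.withDensity fun y => ENNReal.ofReal (f y) with hν
  have hνu : ν univ = ∫⁻ v, ENNReal.ofReal (f v) := by
    rw [hν, withDensity_apply _ MeasurableSet.univ, setLIntegral_univ]
  have : IsFiniteMeasure ν := ⟨by rw [hνu]; exact hmass.2.trans_lt ENNReal.ofReal_lt_top⟩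
  have hlint : ∀ g : En n → ℝ, Measurable g →
      ∫⁻ y, ENNReal.ofReal (g y) ∂ν = ∫⁻ y, ENNReal.ofReal (f y * g y) := fun g hg => by
    rw [hν, lintegral_withDensity_eq_lintegral_mul _ hfm (by fun_prop)]
    exact lintegral_congr fun y => by rw [Pi.mul_apply, ENNReal.ofReal_mul (hf0 y)]
  have hpowm : Measurable fun y : En n => ‖y‖ ^ q := by fun_prop
  have hpow0 : ∀ y : En n, 0 ≤ ‖y‖ ^ q := fun y => Real.rpow_nonneg (norm_nonneg y) q
  have hmom' : ∫⁻ y, ENNReal.ofReal (‖y‖ ^ q) ∂ν ≤ ENNReal.ofReal K := by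
    rw [hlint _ hpowm]
    exact hmom.trans (ENNReal.ofReal_le_ofReal (le_max_left _ _))
  have hint : Integrable (fun y => ‖y‖ ^ q) ν := by
    refine ⟨hpowm.aestronglyMeasurable, ?_⟩
    rw [hasFiniteIntegral_iff_ofReal (Filter.Eventually.of_forall hpow0)]
    exact hmom'.trans_lt ENNReal.ofReal_lt_top
  have hbar : (ν.real univ)⁻¹ • ∫ y, y ∂ν = vbar f := by
    have h1 : ν.real univ = ∫ v, f v := by
      rw [measureReal_def, hνu, integral_eq_lintegral_of_nonneg_ae
        (Filter.Eventually.of_forall hf0) hf.aestronglyMeasurable]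
    have h2 : ∫ y, y ∂ν = ∫ v, f v • v := by
      rw [hν, integral_withDensity_eq_integral_toReal_smul hfm
        (Filter.Eventually.of_forall fun _ => ENNReal.ofReal_lt_top)]
      exact integral_congr_ae (Filter.Eventually.of_forall fun y => by
        simp only [ENNReal.toReal_ofReal (hf0 y)])
    rw [h1, h2, vbar]
  have hp : p₀ / 2 ≤ ∫ y, ⟪y - (ν.real univ)⁻¹ • ∫ y, y ∂ν, e⟫ ^ 2 ∂ν := by
    rw [hbar, integral_eq_lintegral_of_nonneg_ae (Filter.Eventually.of_forall fun y => sq_nonneg _)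
      (by fun_prop)]
    have h1 : ∫⁻ w, ENNReal.ofReal (f (vbar f + w) * ⟪w, e⟫ ^ 2) =
        ∫⁻ y, ENNReal.ofReal (⟪y - vbar f, e⟫ ^ 2) ∂ν := by
      rw [hlint _ (by fun_prop)]
      simpa using lintegral_add_left_eq_self
        (fun y => ENNReal.ofReal (f y * ⟪y - vbar f, e⟫ ^ 2)) (vbar f)
    rw [h1] at hpe
    have hfin : ∫⁻ y, ENNReal.ofReal (⟪y - vbar f, e⟫ ^ 2) ∂ν ≠ ⊤ := by
      have h2 : ∀ y : En n, ⟪y - vbar f, e⟫ ^ 2 ≤ 2 * (1 + ‖vbar f‖ ^ 2) + 2 * ‖y‖ ^ q := fun y => by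
        have h3 : |⟪y - vbar f, e⟫| ≤ ‖y‖ + ‖vbar f‖ := by
          refine (abs_real_inner_le_norm _ _).trans ?_
          rw [he, mul_one]; exact norm_sub_le _ _
        have h4 : ‖y‖ ^ 2 ≤ 1 + ‖y‖ ^ q := by
          rcases le_total ‖y‖ 1 with h | h
          · nlinarith [norm_nonneg y, hpow0 y]
          · have := Real.rpow_le_rpow_of_exponent_le h hq.le
            rw [Real.rpow_two] at this
            linarith
        rw [← sq_abs]
        nlinarith [pow_le_pow_left₀ (abs_nonneg _) h3 2, sq_nonneg (‖y‖ - ‖vbar f‖)]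
      have h5 : Integrable (fun y : En n => ⟪y - vbar f, e⟫ ^ 2) ν :=
        ((integrable_const (2 * (1 + ‖vbar f‖ ^ 2))).add (hint.const_mul 2)).mono' (by fun_prop)
          (Filter.Eventually.of_forall fun y => by
            rw [Real.norm_eq_abs, abs_of_nonneg (sq_nonneg _)]; exact h2 y)
      exact ((hasFiniteIntegral_iff_ofReal
        (Filter.Eventually.of_forall fun y => sq_nonneg _)).1 h5.2).ne
    have := (ENNReal.ofReal_le_iff_le_toReal hfin).1 hpe
    linarith
  have hfinu : ν univ ≠ ⊤ := measure_ne_top _ _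
  have key := measure_off_slab ν hq hR1 hδ0 hδ1 hm₀
    (by rw [measureReal_def, ← ENNReal.ofReal_le_iff_le_toReal hfinu, hνu]; exact hmass.1)
    (by
      refine ENNReal.toReal_le_of_le_ofReal hM.le ?_
      rw [hνu]; exact hmass.2.trans (ENNReal.ofReal_le_ofReal (le_max_left _ _)))
    hint
    (by
      rw [integral_eq_lintegral_of_nonneg_ae (Filter.Eventually.of_forall hpow0)
        hpowm.aestronglyMeasurable]
      exact ENNReal.toReal_le_of_le_ofReal hK.le hmom')
    he hp hδp hRp hRm a
  rw [measureReal_def, ← ENNReal.ofReal_le_iff_le_toReal (measure_ne_top _ _), hν,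
    withDensity_apply'] at key
  exact key

/-- The linear map scaling the direction of the unit vector `ν` by the factor `b` and fixing its
orthogonal complement. -/
def scaleDir {n : ℕ} (b : ℝ) (ν h : En n) : En n := h + ((b - 1) * ⟪h, ν⟫) • ν

lemma scaleDir_one {n : ℕ} (ν h : En n) : scaleDir 1 ν h = h := by simp [scaleDir]

lemma norm_scaleDir_sq {n : ℕ} (b : ℝ) {ν : En n} (hν : ‖ν‖ = 1) (h : En n) :
    ‖scaleDir b ν h‖ ^ 2 = ‖h‖ ^ 2 + (b ^ 2 - 1) * ⟪h, ν⟫ ^ 2 := by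
  rw [scaleDir, norm_add_sq_real, inner_smul_right, norm_smul, hν, mul_one, Real.norm_eq_abs,
    sq_abs]
  ring

lemma norm_le_norm_scaleDir {n : ℕ} {b : ℝ} (hb : 1 ≤ b) {ν : En n} (hν : ‖ν‖ = 1) (h : En n) :
    ‖h‖ ≤ ‖scaleDir b ν h‖ := by
  refine (sq_le_sq₀ (norm_nonneg _) (norm_nonneg _)).1 ?_
  rw [norm_scaleDir_sq b hν]
  have : 0 ≤ (b ^ 2 - 1) * ⟪h, ν⟫ ^ 2 := mul_nonneg (by nlinarith) (sq_nonneg _)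
  linarith

lemma norm_scaleDir_le {n : ℕ} {b : ℝ} (hb0 : 0 ≤ b) (hb : b ≤ 1) {ν : En n} (hν : ‖ν‖ = 1)
    (h : En n) : ‖scaleDir b ν h‖ ≤ ‖h‖ := by
  refine (sq_le_sq₀ (norm_nonneg _) (norm_nonneg _)).1 ?_
  rw [norm_scaleDir_sq b hν]
  have : 0 ≤ (1 - b ^ 2) * ⟪h, ν⟫ ^ 2 := mul_nonneg (by nlinarith) (sq_nonneg _)
  linarith

/-- A vector `w` with a component at least `δ` orthogonal to `u` is quantitatively transversal
to `u`. -/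
lemma le_norm_sub_smul_of_inner {n : ℕ} {u w e : En n} {δ A t : ℝ} (he : ‖e‖ = 1)
    (heu : ⟪e, u⟫ = 0) (hδ : δ ≤ |⟪w, e⟫|) (hw : ‖w‖ ≤ A) (hA : 0 < A) :
    ‖u‖ * δ / (2 * A) ≤ ‖u - t • w‖ := by
  rcases eq_or_ne u 0 with rfl | hu
  · simp
  have hu0 : 0 < ‖u‖ := norm_pos_iff.2 hu
  have h1 : ⟪u - t • w, ⟪w, e⟫ • u - ⟪w, u⟫ • e⟫ = ‖u‖ ^ 2 * ⟪w, e⟫ := by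
    simp only [inner_sub_left, inner_sub_right, inner_smul_left, inner_smul_right,
      real_inner_self_eq_norm_sq, real_inner_comm e u, heu]
    simp
    ring
  have h2 : ‖⟪w, e⟫ • u - ⟪w, u⟫ • e‖ ≤ 2 * (A * ‖u‖) := by
    refine (norm_sub_le _ _).trans ?_
    rw [norm_smul, norm_smul, he, mul_one, Real.norm_eq_abs, Real.norm_eq_abs]
    have h3 := abs_real_inner_le_norm w e
    have h4 := abs_real_inner_le_norm w u
    rw [he, mul_one] at h3
    nlinarith
  have h3 := abs_real_inner_le_norm (u - t • w) (⟪w, e⟫ • u - ⟪w, u⟫ • e)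
  rw [h1, abs_mul, abs_of_pos (by positivity : 0 < ‖u‖ ^ 2)] at h3
  have h4 : ‖u‖ ^ 2 * δ ≤ ‖u - t • w‖ * (2 * (A * ‖u‖)) :=
    (mul_le_mul_of_nonneg_left hδ (by positivity)).trans
      (h3.trans (mul_le_mul_of_nonneg_left h2 (norm_nonneg _)))
  rw [div_le_iff₀ (by positivity)]
  have h5 : ‖u‖ * (‖u‖ * δ) ≤ ‖u‖ * (‖u - t • w‖ * (2 * A)) := by linarith
  exact le_of_mul_le_mul_left h5 hu0

/-- If the stretched direction `scaleDir N ν e` is short compared with `N`, it is transversal to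
every vector close to `-N • ν`. -/
lemma le_norm_sub_smul_of_short {n : ℕ} {e ν g : En n} {N c A t : ℝ} (he : ‖e‖ = 1)
    (hν : ‖ν‖ = 1) (hN : 1 ≤ N) (hA : 2 ≤ A) (hc : c = 1 / (16 * A)) (hg : ‖g‖ ≤ A)
    (hu : ‖scaleDir N ν e‖ < c * N) :
    1 / 4 ≤ ‖scaleDir N ν e - t • (-(N • ν) + g)‖ := by
  by_contra! hlt
  have hN0 : 0 < N := by linarith
  have hA0 : 0 < A := by linarith
  have hc0 : 0 < c := by rw [hc]; positivity
  have hcA : c * A = 1 / 16 := by rw [hc]; field_simp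
  set a : ℝ := ⟪e, ν⟫ with ha
  have hu1 : 1 ≤ ‖scaleDir N ν e‖ := he ▸ norm_le_norm_scaleDir hN hν e
  have hinner : ⟪scaleDir N ν e, ν⟫ = N * a := by
    rw [scaleDir, inner_add_left, inner_smul_left, real_inner_self_eq_norm_sq, hν]
    simp [← ha]; ring
  have ha1 : |a| ≤ c := by
    have h1 := abs_real_inner_le_norm (scaleDir N ν e) ν
    rw [hinner, hν, mul_one, abs_mul, abs_of_pos hN0] at h1
    nlinarith
  have hc1 : c ≤ 1 / 2 := by
    rw [hc, div_le_div_iff₀ (by positivity) (by positivity)]; linarith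
  set e' : En n := e - a • ν with he'
  have hνe' : ⟪ν, e'⟫ = 0 := by
    rw [he', inner_sub_right, inner_smul_right, real_inner_self_eq_norm_sq, hν, real_inner_comm,
      ← ha]
    simp
  have hee' : ⟪e, e'⟫ = 1 - a ^ 2 := by
    rw [he', inner_sub_right, inner_smul_right, real_inner_self_eq_norm_sq, he, ← ha]
    ring
  have ha2 : a ^ 2 ≤ 1 / 4 := by
    rw [← sq_abs]; nlinarith [abs_nonneg a]
  have hne' : ‖e'‖ ≤ 1 := by
    have h1 : ‖e'‖ ^ 2 = 1 - a ^ 2 := by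
      rw [← real_inner_self_eq_norm_sq]
      nth_rewrite 1 [he']
      rw [inner_sub_left, inner_smul_left, hee', hνe']
      simp
    nlinarith [norm_nonneg e', sq_nonneg a]
  have hw : N / 2 ≤ ‖-(N • ν) + g‖ := by
    have h1 : ‖-(N • ν)‖ = N := by rw [norm_neg, norm_smul, hν, mul_one, Real.norm_of_nonneg hN0.le]
    have h2 := norm_sub_le_norm_add (-(N • ν)) g
    rw [h1] at h2
    have h3 : A ≤ N / 16 := by
      have : 1 < c * N := hu1.trans_lt hu
      nlinarith
    linarith
  have ht : |t| ≤ 4 * c := by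
    have h1 := norm_sub_norm_le (t • (-(N • ν) + g)) (scaleDir N ν e)
    rw [norm_sub_rev, norm_smul, Real.norm_eq_abs] at h1
    have h2 : |t| * (N / 2) ≤ |t| * ‖-(N • ν) + g‖ := by gcongr
    have h3 : |t| * (N / 2) ≤ 2 * c * N := by linarith
    nlinarith
  have h1 : ⟪scaleDir N ν e - t • (-(N • ν) + g), e'⟫ = 1 - a ^ 2 - t * ⟪g, e'⟫ := by
    rw [inner_sub_left, scaleDir, inner_add_left, inner_smul_left, inner_smul_left, inner_add_left,
      inner_neg_left, inner_smul_left, hνe', hee']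
    simp
  have h2 : |t * ⟪g, e'⟫| ≤ 4 * c * A := by
    rw [abs_mul]
    have h3 := abs_real_inner_le_norm g e'
    have h4 : ‖g‖ * ‖e'‖ ≤ A * 1 := by gcongr
    have h5 : |⟪g, e'⟫| ≤ A := by linarith
    gcongr
  have h3 := le_abs_self ⟪scaleDir N ν e - t • (-(N • ν) + g), e'⟫
  have h4 := abs_real_inner_le_norm (scaleDir N ν e - t • (-(N • ν) + g)) e'
  have h5 : ‖scaleDir N ν e - t • (-(N • ν) + g)‖ * ‖e'‖ ≤ 1 / 4 * 1 := by gcongr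
  have h6 := (abs_le.1 h2).2
  linarith

/-- `w = y - v₁` with `y` in a fixed ball off a slab is comparable in size with `N`, transversal
to the stretched direction, and its orthogonal complement is not much stretched. -/
lemma good_of_off_slab {n : ℕ} {R δ N t : ℝ} {v₀ v₁ ν e e' w : En n} (hR : 1 ≤ R) (hδ : 0 < δ)
    (hδ1 : δ ≤ 1) (he : ‖e‖ = 1) (hν : ‖ν‖ = 1)
    (hv₀ : N = 1 ∧ ‖v₀‖ < 2 ∨ 2 ≤ N ∧ v₀ = N • ν) (hv₁ : ‖v₁ - v₀‖ ≤ 2)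
    (he' : ‖e'‖ = 1) (heu : ⟪e', scaleDir N ν e⟫ = 0)
    (hy : ‖v₁ + w‖ ≤ R) (hs : δ ≤ |⟪w, e'⟫|) :
    δ / (2 * (R + 4)) * N ≤ ‖w‖ ∧ δ / (2 * (R + 4)) * ‖w‖ ≤ N ∧
      δ / (32 * (R + 2) * (R + 4)) ≤ ‖scaleDir N ν e - t • w‖ ∧
      ∀ h, ⟪h, w⟫ = 0 → ‖h‖ ≤ ‖scaleDir N ν h‖ ∧ ‖scaleDir N ν h‖ ≤ (R + 3) * ‖h‖ := by
  have hN : 1 ≤ N := by rcases hv₀ with h | h <;> linarith [h.1]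
  have hN0 : 0 < N := by linarith
  have hv0N : ‖v₀‖ ≤ 2 * N := by
    rcases hv₀ with ⟨h1, h2⟩ | ⟨h1, h2⟩
    · linarith
    · rw [h2, norm_smul, hν, mul_one, Real.norm_of_nonneg hN0.le]; linarith
  set g : En n := v₁ + w - (v₁ - v₀) with hg
  have hgn : ‖g‖ ≤ R + 2 := (norm_sub_le _ _).trans (add_le_add hy hv₁)
  have hwg : w = -v₀ + g := by rw [hg]; abel
  have hw1 : ‖w‖ ≤ (R + 4) * N := by
    rw [hwg]
    refine (norm_add_le _ _).trans ?_
    rw [norm_neg]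
    nlinarith
  have hw2 : δ ≤ ‖w‖ := by
    refine hs.trans ((abs_real_inner_le_norm _ _).trans ?_)
    rw [he', mul_one]
  refine ⟨?_, ?_, ?_, fun h hh => ⟨norm_le_norm_scaleDir hN hν h, ?_⟩⟩
  · rw [div_mul_eq_mul_div, div_le_iff₀ (by positivity)]
    rcases le_or_gt N (2 * (R + 4)) with h | h
    · nlinarith
    · have h2 : v₀ = N • ν := by
        rcases hv₀ with h1 | h1
        · linarith [h1.1]
        · exact h1.2
      have h3 := norm_sub_le_norm_add (-v₀) g
      rw [← hwg, norm_neg, h2, norm_smul, hν, mul_one, Real.norm_of_nonneg hN0.le] at h3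
      have h4 : N / 2 ≤ ‖w‖ := by linarith
      nlinarith
  · rw [div_mul_eq_mul_div, div_le_iff₀ (by positivity)]
    nlinarith [norm_nonneg w]
  · rcases le_or_gt (1 / (16 * (R + 2)) * N) ‖scaleDir N ν e‖ with h | h
    · refine le_trans ?_ (le_norm_sub_smul_of_inner he' heu hs hw1 (by positivity))
      calc δ / (32 * (R + 2) * (R + 4)) =
            (1 / (16 * (R + 2)) * N) * δ / (2 * ((R + 4) * N)) := by field_simp; norm_num
        _ ≤ _ := by gcongr
    · have h2 : v₀ = N • ν := by
        rcases hv₀ with h1 | h1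
        · have h3 : 1 ≤ ‖scaleDir N ν e‖ := he ▸ norm_le_norm_scaleDir hN hν e
          have h4 : 1 / (16 * (R + 2)) * N ≤ 1 := by
            rw [h1.1, mul_one, div_le_one (by positivity)]; linarith
          linarith
        · exact h1.2
      rw [hwg, h2]
      refine le_trans ?_ (le_norm_sub_smul_of_short he hν hN (by linarith) rfl hgn h)
      rw [div_le_div_iff₀ (by positivity) (by positivity)]
      nlinarith
  · rcases hv₀ with ⟨h1, h2⟩ | ⟨h1, h2⟩
    · rw [h1, scaleDir_one]
      nlinarith [norm_nonneg h]
    · have h3 : N * ⟪h, ν⟫ = ⟪h, g⟫ := by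
        have : ⟪h, w⟫ = -(N * ⟪h, ν⟫) + ⟪h, g⟫ := by
          rw [hwg, h2, inner_add_right, inner_neg_right, inner_smul_right]
        linarith
      have h4 : N * |⟪h, ν⟫| ≤ ‖h‖ * (R + 2) := by
        have h5 : N * |⟪h, ν⟫| = |⟪h, g⟫| := by rw [← h3, abs_mul, abs_of_pos hN0]
        rw [h5]
        exact (abs_real_inner_le_norm _ _).trans (by gcongr)
      rw [scaleDir]
      refine (norm_add_le _ _).trans ?_
      rw [norm_smul, hν, mul_one, Real.norm_eq_abs, abs_mul, abs_of_nonneg (by linarith)]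
      nlinarith [abs_nonneg ⟪h, ν⟫]

lemma continuous_scaleDir {n : ℕ} (b : ℝ) (ν : En n) : Continuous (scaleDir b ν) := by
  unfold scaleDir
  fun_prop

lemma inner_scaleDir_comm {n : ℕ} (b : ℝ) (ν h e : En n) :
    ⟪scaleDir b ν h, e⟫ = ⟪h, scaleDir b ν e⟫ := by
  simp only [scaleDir, inner_add_left, inner_add_right, inner_smul_left, inner_smul_right,
    real_inner_comm ν e]
  simp
  ring

lemma scaleDir_scaleDir_inv {n : ℕ} {N : ℝ} (hN : 0 < N) {ν : En n} (hν : ‖ν‖ = 1) (h : En n) :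
    scaleDir N ν (scaleDir (1 / N) ν h) = h := by
  have h1 : ⟪scaleDir (1 / N) ν h, ν⟫ = 1 / N * ⟪h, ν⟫ := by
    rw [scaleDir, inner_add_left, inner_smul_left, real_inner_self_eq_norm_sq, hν]
    simp; ring
  rw [scaleDir, h1, scaleDir, add_assoc, ← add_smul]
  have : (1 / N - 1) * ⟪h, ν⟫ + (N - 1) * (1 / N * ⟪h, ν⟫) = 0 := by field_simp; ring
  rw [this, zero_smul, add_zero]

lemma lintegral_comp_scaleDir_inv {n : ℕ} {N : ℝ} (hN : 0 < N) {ν : En n} (hν : ‖ν‖ = 1)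
    (G : En n → ℝ≥0∞) :
    ∫⁻ h, G (scaleDir (1 / N) ν h) = ENNReal.ofReal N * ∫⁻ h, G h := by
  let T : En n →ₗ[ℝ] En n := LinearMap.transvection ((1 / N - 1) • (innerₛₗ ℝ ν)) ν
  have hT : ∀ h, T h = scaleDir (1 / N) ν h := fun h => by
    simp [T, LinearMap.transvection.apply, scaleDir, real_inner_comm]
  have hdet : LinearMap.det T = 1 / N := by
    simp [T, hν]
  have hmap := Measure.map_linearMap_addHaar_eq_smul_addHaar (volume : Measure (En n))
    (f := T) (by rw [hdet]; positivity)
  have hemb : MeasurableEmbedding T := by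
    refine (LinearMap.continuous_of_finiteDimensional T).measurableEmbedding fun x y hxy => ?_
    rw [hT, hT] at hxy
    rw [← scaleDir_scaleDir_inv hN hν x, hxy, scaleDir_scaleDir_inv hN hν]
  simp_rw [← hT]
  rw [← hemb.lintegral_map, hmap, lintegral_smul_measure, hdet]
  simp [abs_of_pos hN]

/-- The transformed kernel is the original kernel composed with a scaling by `1 / N` in
direction `ν`. -/
lemma exists_KtildeE_eq {n : ℕ} (v₀ e : En n) (he : ‖e‖ = 1) :
    ∃ (N : ℝ) (ν : En n), ‖ν‖ = 1 ∧ (N = 1 ∧ ‖v₀‖ < 2 ∨ 2 ≤ N ∧ v₀ = N • ν) ∧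
      ∀ v : En n, ‖v‖ < 2 → ∃ v₁, ‖v₁ - v₀‖ ≤ 2 ∧ ∀ (s γ : ℝ) (f : En n → ℝ) (h : En n),
        KtildeE n s γ f v₀ v (v + h) = ENNReal.ofReal (N ^ (-1 - γ - 2 * s)) *
          KfE n s γ f v₁ (v₁ + scaleDir (1 / N) ν h) := by
  rcases lt_or_ge ‖v₀‖ 2 with h0 | h0
  · refine ⟨1, e, he, Or.inl ⟨rfl, h0⟩, fun v hv => ⟨v₀ + v, by simpa using hv.le, ?_⟩⟩
    intro s γ f h
    simp [KtildeE, not_le.2 h0, scaleDir, add_assoc]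
  · have hN : 0 < ‖v₀‖ := by linarith
    have hν : ‖‖v₀‖⁻¹ • v₀‖ = 1 := by
      rw [norm_smul, norm_inv, norm_norm, inv_mul_cancel₀ hN.ne']
    have htau : ∀ u, tau0 v₀ u = scaleDir (1 / ‖v₀‖) (‖v₀‖⁻¹ • v₀) u := by
      intro u
      rw [tau0, if_pos h0, scaleDir, inner_smul_right, smul_smul]
      congr 2
      field_simp
    refine ⟨‖v₀‖, ‖v₀‖⁻¹ • v₀, hν, Or.inr ⟨h0, ?_⟩, fun v hv => ⟨v₀ + tau0 v₀ v, ?_, ?_⟩⟩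
    · rw [smul_smul, mul_inv_cancel₀ hN.ne', one_smul]
    · rw [add_sub_cancel_left, htau]
      refine (norm_scaleDir_le (by positivity) ?_ hν v).trans hv.le
      rw [div_le_one hN]; linarith
    · intro s γ f h
      rw [KtildeE, if_pos h0]
      congr 2
      rw [htau, htau, scaleDir, scaleDir, scaleDir, inner_add_left, mul_add, add_smul]
      abel

/-- Lower bound of the second directional moment of the kernel by an integral over the
velocities `w` of the collision partners. -/
lemma lintegral_le_KfE {m : ℕ} {s γ B : ℝ} {f : En (m + 1) → ℝ} (hf : Measurable f)
    (hs : s < 1) {i j : Fin (m + 1)} (hij : i ≠ j) (v₁ u : En (m + 1))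
    {E G : Set (En (m + 1))} (hE : MeasurableSet E) (hG : MeasurableSet G)
    (hB : ∀ w ∈ G, ENNReal.ofReal (B / ‖w‖) ≤
      ∫⁻ y : Fin m → ℝ, ENNReal.ofReal (|perpE j w y i| / |w j|) *
        (E.indicator (fun h =>
          ENNReal.ofReal (‖h‖ ^ (-((m + 1 : ℕ) : ℝ) - 2 * s) * max ⟪h, u⟫ 0 ^ 2))
            (perpE j w y))) :
    ∫⁻ w in G, ENNReal.ofReal (B / ‖w‖) *
        ENNReal.ofReal ((1 - s) * (f (v₁ + w) * ‖w‖ ^ (γ + 2 * s + 1))) ≤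
      ∫⁻ h in E, KfE (m + 1) s γ f v₁ (v₁ + h) * ENNReal.ofReal (max ⟪h, u⟫ 0 ^ 2) := by
  set g : En (m + 1) → ℝ≥0∞ := fun h =>
    ENNReal.ofReal (‖h‖ ^ (-((m + 1 : ℕ) : ℝ) - 2 * s) * max ⟪h, u⟫ 0 ^ 2) with hg
  set k : En (m + 1) → ℝ≥0∞ := fun w =>
    ENNReal.ofReal ((1 - s) * (f (v₁ + w) * ‖w‖ ^ (γ + 2 * s + 1))) with hk
  set D : Set (En (m + 1)) := {h | h i ≠ 0} with hD
  have hDm : MeasurableSet D := (measurable_coordE i (measurableSet_singleton 0)).compl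
  have hgm : Measurable g := by
    refine ENNReal.measurable_ofReal.comp (Measurable.mul ?_ ?_)
    · exact measurable_norm.pow_const _
    · exact ((Measurable.max (by fun_prop) measurable_const).pow_const 2)
  have hkm : Measurable k := by
    refine ENNReal.measurable_ofReal.comp (Measurable.const_mul (Measurable.mul ?_ ?_) _)
    · exact hf.comp (measurable_const_add v₁)
    · exact measurable_norm.pow_const _
  have hswap := lintegral_swap_perp i j hij
    (F := fun h w => (E ∩ D).indicator g h * k w)
    (((hgm.indicator (hE.inter hDm)).comp measurable_fst).mul (hkm.comp measurable_snd))
  rw [← lintegral_indicator hG, ← lintegral_indicator hE]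
  refine le_trans (lintegral_mono fun w => ?_) (hswap.trans (lintegral_mono fun h => ?_))
  · by_cases hw : w ∈ G
    swap
    · rw [Set.indicator_of_notMem hw]
      exact zero_le
    rw [Set.indicator_of_mem hw]
    calc _ ≤ (∫⁻ y : Fin m → ℝ, ENNReal.ofReal (|perpE j w y i| / |w j|) *
          E.indicator g (perpE j w y)) * k w := by gcongr; exact hB w hw
      _ = ∫⁻ y : Fin m → ℝ, ENNReal.ofReal (|perpE j w y i| / |w j|) *
          E.indicator g (perpE j w y) * k w :=
        (lintegral_mul_const' _ _ ENNReal.ofReal_ne_top).symm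
      _ ≤ _ := by
        refine lintegral_mono fun y => ?_
        rw [mul_assoc]
        by_cases hy : perpE j w y i = 0
        · simp [hy]
        · refine le_of_eq ?_
          congr 2
          by_cases hyE : perpE j w y ∈ E
          · rw [Set.indicator_of_mem hyE, Set.indicator_of_mem (show _ ∈ E ∩ D from ⟨hyE, hy⟩)]
          · rw [Set.indicator_of_notMem hyE, Set.indicator_of_notMem fun h => hyE h.1]
  · by_cases hh : h ∈ E ∩ D
    · rw [Set.indicator_of_mem hh.1]
      simp only [Set.indicator_of_mem hh]
      rw [lintegral_const_mul' _ _ ENNReal.ofReal_ne_top]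
      have h1 := lintegral_perpE_le i h hh.2 hkm
      have h2 : ∀ w, k w = ENNReal.ofReal (1 - s) *
          ENNReal.ofReal (f (v₁ + w) * ‖w‖ ^ (γ + 2 * s + 1)) := fun w =>
        ENNReal.ofReal_mul (by linarith)
      refine (mul_le_mul_right h1 _).trans (le_of_eq ?_)
      simp_rw [h2]
      rw [lintegral_const_mul' _ _ ENNReal.ofReal_ne_top, KfE, add_sub_cancel_left]
      rw [ENNReal.ofReal_mul (by positivity), ENNReal.ofReal_mul (by linarith)]
      ring
    · simp only [Set.indicator_of_notMem hh]
      simp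

lemma rpow_le_rpow_neg_mul_rpow {c N x β A : ℝ} (hc : 0 < c) (hc1 : c ≤ 1) (hN : 0 < N)
    (hx : 0 < x) (h1 : c * N ≤ x) (h2 : c * x ≤ N) (hβ : |β| ≤ A) :
    c ^ A ≤ N ^ (-β) * x ^ β := by
  have key : N ^ (-β) * x ^ β = (x / N) ^ β := by
    rw [Real.div_rpow hx.le hN.le, Real.rpow_neg hN.le]; ring
  rw [key]
  refine (Real.rpow_le_rpow_of_exponent_ge hc hc1 hβ).trans ?_
  rcases le_total 0 β with h | h
  · rw [abs_of_nonneg h]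
    exact Real.rpow_le_rpow hc.le ((le_div_iff₀ hN).2 h1) h
  · rw [abs_of_nonpos h, ← inv_div, Real.inv_rpow (by positivity), ← Real.rpow_neg (by positivity)]
    exact Real.rpow_le_rpow hc.le ((le_div_iff₀ hx).2 h2) (by linarith)

/-- One of the sectors `‖w‖ ≤ (m + 1) |w j|` carries a fixed proportion of a given mass. -/
lemma exists_sector_mass {m : ℕ} {μ : ℝ} (g : En (m + 1) → ℝ≥0∞) (G : Set (En (m + 1)))
    (hμ : ENNReal.ofReal μ ≤ ∫⁻ w in G, g w) :
    ∃ j, ENNReal.ofReal (μ / (m + 1)) ≤ ∫⁻ w in G ∩ {w | ‖w‖ ≤ (m + 1) * |w j|}, g w := by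
  obtain ⟨j, -, hj⟩ := Finset.exists_max_image Finset.univ
    (fun j : Fin (m + 1) => ∫⁻ w in G ∩ {w | ‖w‖ ≤ (m + 1) * |w j|}, g w) Finset.univ_nonempty
  refine ⟨j, ?_⟩
  have hcov : G ⊆ ⋃ j : Fin (m + 1), G ∩ {w | ‖w‖ ≤ (m + 1) * |w j|} := by
    intro w hw
    obtain ⟨k, -, hk⟩ := Finset.exists_max_image Finset.univ
      (fun k : Fin (m + 1) => |w k|) Finset.univ_nonempty
    refine Set.mem_iUnion.2 ⟨k, hw, (norm_le_sum_abs w).trans ?_⟩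
    refine (Finset.sum_le_card_nsmul _ _ _ hk).trans (le_of_eq ?_)
    simp
  have h1 : ENNReal.ofReal μ ≤
      (∫⁻ w in G ∩ {w | ‖w‖ ≤ (m + 1) * |w j|}, g w) * ENNReal.ofReal (m + 1) := by
    refine hμ.trans ((lintegral_mono_set hcov).trans ((lintegral_iUnion_le _ _).trans ?_))
    rw [tsum_fintype]
    refine (Finset.sum_le_card_nsmul _ _ _ hj).trans (le_of_eq ?_)
    rw [Finset.card_univ, Fintype.card_fin, nsmul_eq_mul, mul_comm]
    congr 1
    rw [show ((m : ℝ) + 1) = ((m + 1 : ℕ) : ℝ) by push_cast; ring, ENNReal.ofReal_natCast]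
  rw [ENNReal.ofReal_div_of_pos (by positivity)]
  exact ENNReal.div_le_of_le_mul h1

/-- Lower bound on the contribution of a single annulus. -/
lemma exists_annulus_lower (m : ℕ) (hm : 1 ≤ m) (γ₀ m₀ M₀ p₀ Mq q : ℝ) (hm₀ : 0 < m₀)
    (hp₀ : 0 < p₀) (hq : 2 < q) :
    ∃ κ c : ℝ, 0 < κ ∧ κ < 1 ∧ 0 < c ∧
      ∀ s γ : ℝ, s ∈ Set.Ioo (0:ℝ) 1 → -((m + 1 : ℕ) : ℝ) < γ → γ ≤ γ₀ →
        ∀ f : En (m + 1) → ℝ, Measurable f → (∀ v, 0 ≤ f v) →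
          MassBound f m₀ M₀ → PressureLB f p₀ → MomentBound f q Mq →
          ∀ (v₀ : En (m + 1)) (ρ : ℝ) (v e : En (m + 1)), 0 < ρ → ‖v‖ < 2 → ‖e‖ = 1 →
            ENNReal.ofReal (c * (1 - s) * ρ ^ (2 - 2 * s)) ≤
              ∫⁻ h in {h | κ * ρ ≤ ‖h‖ ∧ ‖h‖ < ρ},
                KtildeE (m + 1) s γ f v₀ v (v + h) * ENNReal.ofReal (max ⟪h, e⟫ 0 ^ 2) := by
  obtain ⟨R, δ, μ, hR, hδ, hδ1, hμ, hmass⟩ :=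
    exists_mass_off_slab (m + 1) m₀ M₀ p₀ Mq q hm₀ hp₀ hq
  obtain ⟨κ, c₀, hκ, hκ1, hc₀, hinner⟩ := exists_inner_lower m (by linarith : 1 ≤ R + 3)
  set c₁ : ℝ := δ / (2 * (R + 4)) with hc₁
  set d : ℝ := δ / (32 * (R + 2) * (R + 4)) with hd
  set A : ℝ := |γ₀| + m + 3 with hA
  have hc₁0 : 0 < c₁ := by positivity
  have hc₁1 : c₁ ≤ 1 := by rw [hc₁, div_le_one (by positivity)]; linarith
  have hd0 : 0 < d := by positivity
  refine ⟨κ, μ / (m + 1) * (c₀ * d ^ 2 * c₁ ^ A), hκ, hκ1, by positivity, ?_⟩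
  intro s γ hs hγ hγ₀ f hf hf0 hMass hPress hMom v₀ ρ v e hρ hv he
  obtain ⟨N, ν, hν, hNν, hK⟩ := exists_KtildeE_eq v₀ e he
  obtain ⟨v₁, hv₁, hK⟩ := hK v hv
  have hN1 : 1 ≤ N := by rcases hNν with h | h <;> linarith [h.1]
  have hN : 0 < N := by linarith
  set u : En (m + 1) := scaleDir N ν e with hu
  have hu1 : 1 ≤ ‖u‖ := he ▸ norm_le_norm_scaleDir hN1 hν e
  obtain ⟨e', he', heu, hmass⟩ := hmass f hf hf0 hMass hPress hMom (‖u‖⁻¹ • u) (by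
    rw [norm_smul, norm_inv, norm_norm, inv_mul_cancel₀ (by linarith)])
  replace heu : ⟪e', u⟫ = 0 := by
    rw [inner_smul_right] at heu
    exact (mul_eq_zero.1 heu).resolve_left (by positivity)
  set G : Set (En (m + 1)) := {w | ‖v₁ + w‖ ≤ R ∧ δ ≤ |⟪w, e'⟫|} with hG
  have hGm : MeasurableSet G := by
    rw [hG, Set.ofPred_and]
    refine (isClosed_le ?_ ?_).measurableSet.inter (isClosed_le ?_ ?_).measurableSet <;> fun_prop
  have hmassG : ENNReal.ofReal μ ≤ ∫⁻ w in G, ENNReal.ofReal (f (v₁ + w)) := by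
    have hYm : MeasurableSet {y : En (m + 1) | ‖y‖ ≤ R ∧ δ ≤ |⟪y, e'⟫ - ⟪v₁, e'⟫|} := by
      rw [Set.ofPred_and]
      refine (isClosed_le ?_ ?_).measurableSet.inter (isClosed_le ?_ ?_).measurableSet <;> fun_prop
    refine (hmass ⟪v₁, e'⟫).trans (le_of_eq ?_)
    rw [← lintegral_indicator hYm, ← lintegral_indicator hGm,
      ← lintegral_add_left_eq_self _ v₁]
    refine lintegral_congr fun w => ?_
    simp only [Set.indicator, Set.mem_ofPred_eq, hG, inner_add_left, add_sub_cancel_left]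
  have hgood := fun (w : En (m + 1)) (hw : w ∈ G) (t : ℝ) =>
    good_of_off_slab (t := t) hR hδ hδ1 he hν hNν hv₁ he' heu hw.1 hw.2
  obtain ⟨j, hj⟩ := exists_sector_mass _ G hmassG
  set Gj : Set (En (m + 1)) := G ∩ {w | ‖w‖ ≤ (m + 1) * |w j|} with hGj
  have hGjm : MeasurableSet Gj :=
    hGm.inter (IsClosed.measurableSet (isClosed_le (by fun_prop) (by fun_prop)))
  have : Nontrivial (Fin (m + 1)) := Fin.nontrivial_iff_two_le.2 (by omega)
  obtain ⟨i, hij⟩ := exists_ne j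
  set E : Set (En (m + 1)) := {h | κ * ρ ≤ ‖scaleDir N ν h‖ ∧ ‖scaleDir N ν h‖ < ρ} with hE
  have hSc := (continuous_scaleDir N ν).norm
  have hEm : MeasurableSet E :=
    (isClosed_le continuous_const hSc).measurableSet.inter
      (isOpen_lt hSc continuous_const).measurableSet
  have hw0 : ∀ w ∈ G, 0 < ‖w‖ := fun w hw =>
    (by positivity : 0 < c₁ * N).trans_le (hgood w hw 0).1
  have hlow := lintegral_le_KfE (γ := γ) hf hs.2 hij v₁ u hEm hGjm fun w hw =>
    hinner s ρ (scaleDir N ν) i j w u d hs.1 hρ hij (norm_pos_iff.1 (hw0 w hw.1)) hw.2 hd0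
      (fun t => (hgood w hw.1 t).2.2.1) (hgood w hw.1 0).2.2.2
  have hAm : MeasurableSet {h : En (m + 1) | κ * ρ ≤ ‖h‖ ∧ ‖h‖ < ρ} :=
    (isClosed_le continuous_const continuous_norm).measurableSet.inter
      (isOpen_lt continuous_norm continuous_const).measurableSet
  have hchange : ∫⁻ h in {h | κ * ρ ≤ ‖h‖ ∧ ‖h‖ < ρ},
        KtildeE (m + 1) s γ f v₀ v (v + h) * ENNReal.ofReal (max ⟪h, e⟫ 0 ^ 2) =
      ENNReal.ofReal N * (ENNReal.ofReal (N ^ (-1 - γ - 2 * s)) *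
        ∫⁻ h in E, KfE (m + 1) s γ f v₁ (v₁ + h) * ENNReal.ofReal (max ⟪h, u⟫ 0 ^ 2)) := by
    rw [← lintegral_indicator hAm, ← lintegral_indicator hEm,
      ← lintegral_const_mul' _ _ ENNReal.ofReal_ne_top, ← lintegral_comp_scaleDir_inv hN hν]
    refine lintegral_congr fun h => ?_
    simp only [Set.indicator, hE, Set.mem_ofPred_eq, scaleDir_scaleDir_inv hN hν]
    split_ifs
    · rw [hK, hu, ← inner_scaleDir_comm, scaleDir_scaleDir_inv hN hν, mul_assoc]
    · simp
  rw [hchange]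
  have hs1 : 0 < 1 - s := by linarith [hs.2]
  have hB0 : 0 ≤ c₀ * d ^ 2 * ρ ^ (2 - 2 * s) := by positivity
  calc ENNReal.ofReal (μ / (m + 1) * (c₀ * d ^ 2 * c₁ ^ A) * (1 - s) * ρ ^ (2 - 2 * s))
      = ENNReal.ofReal (c₀ * d ^ 2 * ρ ^ (2 - 2 * s) * (1 - s) * c₁ ^ A) *
          ENNReal.ofReal (μ / (m + 1)) := by
        rw [← ENNReal.ofReal_mul (by positivity)]; ring_nf
    _ ≤ ENNReal.ofReal (c₀ * d ^ 2 * ρ ^ (2 - 2 * s) * (1 - s) * c₁ ^ A) *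
          ∫⁻ w in Gj, ENNReal.ofReal (f (v₁ + w)) := by gcongr
    _ = ∫⁻ w in Gj, ENNReal.ofReal (c₀ * d ^ 2 * ρ ^ (2 - 2 * s) * (1 - s) * c₁ ^ A) *
          ENNReal.ofReal (f (v₁ + w)) :=
        (lintegral_const_mul' _ _ ENNReal.ofReal_ne_top).symm
    _ ≤ ∫⁻ w in Gj, ENNReal.ofReal N * (ENNReal.ofReal (N ^ (-1 - γ - 2 * s)) *
          (ENNReal.ofReal (c₀ * d ^ 2 * ρ ^ (2 - 2 * s) / ‖w‖) *
            ENNReal.ofReal ((1 - s) * (f (v₁ + w) * ‖w‖ ^ (γ + 2 * s + 1))))) := by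
        refine setLIntegral_mono' hGjm fun w hw => ?_
        have hwp := hw0 w hw.1
        have hpow : c₁ ^ A ≤ N ^ (-(γ + 2 * s)) * ‖w‖ ^ (γ + 2 * s) := by
          refine rpow_le_rpow_neg_mul_rpow hc₁0 hc₁1 hN hwp (hgood w hw.1 0).1
            (hgood w hw.1 0).2.1 (abs_le.2 ⟨?_, ?_⟩)
          · push_cast at hγ
            have := abs_nonneg γ₀
            linarith [hs.1]
          · have := le_abs_self γ₀
            have : (0:ℝ) ≤ m := Nat.cast_nonneg m
            linarith [hs.2]
        rw [← ENNReal.ofReal_mul (by positivity), ← ENNReal.ofReal_mul (by positivity),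
          ← ENNReal.ofReal_mul (by positivity), ← ENNReal.ofReal_mul (by positivity)]
        refine ENNReal.ofReal_le_ofReal ?_
        have hNp : N * N ^ (-1 - γ - 2 * s) = N ^ (-(γ + 2 * s)) := by
          rw [show -(γ + 2 * s) = 1 + (-1 - γ - 2 * s) by ring, Real.rpow_add hN, Real.rpow_one]
        have hwpow : ‖w‖ ^ (γ + 2 * s + 1) = ‖w‖ ^ (γ + 2 * s) * ‖w‖ := by
          rw [Real.rpow_add hwp, Real.rpow_one]
        calc _ ≤ c₀ * d ^ 2 * ρ ^ (2 - 2 * s) * (1 - s) *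
              (N ^ (-(γ + 2 * s)) * ‖w‖ ^ (γ + 2 * s)) * f (v₁ + w) := by
              have := hf0 (v₁ + w)
              gcongr
          _ = _ := by
              rw [← hNp, hwpow]
              field_simp
    _ = ENNReal.ofReal N * (ENNReal.ofReal (N ^ (-1 - γ - 2 * s)) *
          ∫⁻ w in Gj, ENNReal.ofReal (c₀ * d ^ 2 * ρ ^ (2 - 2 * s) / ‖w‖) *
            ENNReal.ofReal ((1 - s) * (f (v₁ + w) * ‖w‖ ^ (γ + 2 * s + 1)))) := by
        rw [lintegral_const_mul' _ _ ENNReal.ofReal_ne_top,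
          lintegral_const_mul' _ _ ENNReal.ofReal_ne_top]
    _ ≤ _ := by gcongr

lemma one_sub_rpow_le {κ a : ℝ} (hκ : 0 < κ) : 1 - κ ^ a ≤ -(a * Real.log κ) := by
  rw [Real.rpow_def_of_pos hκ]
  linarith [Real.add_one_le_exp (Real.log κ * a), mul_comm a (Real.log κ)]

/-- Summation of lower bounds over the dyadic-type annuli that fill a ball. -/
lemma lintegral_ball_ge_of_annulus {n : ℕ} {κ c a r : ℝ} (hκ : 0 < κ) (hκ1 : κ < 1)
    (hc : 0 ≤ c) (ha : 0 < a) (hr : 0 < r) (g : En n → ℝ≥0∞)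
    (hg : ∀ ρ : ℝ, 0 < ρ →
      ENNReal.ofReal (c * a * ρ ^ a) ≤ ∫⁻ h in {h | κ * ρ ≤ ‖h‖ ∧ ‖h‖ < ρ}, g h) :
    ENNReal.ofReal (c / (-Real.log κ) * r ^ a) ≤ ∫⁻ h in Metric.ball 0 r, g h := by
  set D : ℕ → Set (En n) := fun k => {h | κ * (κ ^ k * r) ≤ ‖h‖ ∧ ‖h‖ < κ ^ k * r} with hD
  have hDm : ∀ k, MeasurableSet (D k) := fun k =>
    (isClosed_le continuous_const continuous_norm).measurableSet.inter
      (isOpen_lt continuous_norm continuous_const).measurableSet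
  have hdisj : Pairwise (Function.onFun Disjoint D) := by
    refine (pairwise_disjoint_on D).2 fun k l hkl => Set.disjoint_left.2 fun h hk hl => ?_
    have h1 : κ ^ l ≤ κ ^ (k + 1) := pow_le_pow_of_le_one hκ.le hκ1.le hkl
    have h2 : κ * (κ ^ k * r) < κ ^ l * r := hk.1.trans_lt hl.2
    rw [pow_succ] at h1
    nlinarith
  have hsub : (⋃ k, D k) ⊆ Metric.ball 0 r := by
    refine Set.iUnion_subset fun k h hh => ?_
    rw [mem_ball_zero_iff]
    have : κ ^ k ≤ 1 := pow_le_one₀ hκ.le hκ1.le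
    have := hh.2
    nlinarith
  have hκa : κ ^ a < 1 := Real.rpow_lt_one hκ.le hκ1 ha
  have hκa0 : 0 < κ ^ a := Real.rpow_pos_of_pos hκ a
  have hlog : 0 < -Real.log κ := neg_pos.2 (Real.log_neg hκ hκ1)
  have hsum : HasSum (fun k : ℕ => c * a * (κ ^ k * r) ^ a) (c * a * r ^ a * (1 - κ ^ a)⁻¹) := by
    rw [show (fun k : ℕ => c * a * (κ ^ k * r) ^ a) = fun k => c * a * r ^ a * (κ ^ a) ^ k from
      funext fun k => ?_]
    · exact (hasSum_geometric_of_lt_one hκa0.le hκa).mul_left (c * a * r ^ a)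
    rw [Real.mul_rpow (by positivity) hr.le, ← Real.rpow_natCast, ← Real.rpow_mul hκ.le,
      mul_comm (k : ℝ) a, Real.rpow_mul hκ.le, Real.rpow_natCast]
    ring
  calc ENNReal.ofReal (c / (-Real.log κ) * r ^ a)
      ≤ ENNReal.ofReal (c * a * r ^ a * (1 - κ ^ a)⁻¹) := by
        refine ENNReal.ofReal_le_ofReal ?_
        have h1 := one_sub_rpow_le (a := a) hκ
        have h2 : 0 < 1 - κ ^ a := by linarith
        rw [div_mul_eq_mul_div, ← div_eq_mul_inv, div_le_div_iff₀ hlog h2]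
        have h3 : 0 ≤ c * r ^ a := by positivity
        nlinarith
    _ = ∑' k, ENNReal.ofReal (c * a * (κ ^ k * r) ^ a) := by
        rw [← hsum.tsum_eq, ENNReal.ofReal_tsum_of_nonneg (fun k => by positivity) hsum.summable]
    _ ≤ ∑' k, ∫⁻ h in D k, g h := ENNReal.tsum_le_tsum fun k => hg _ (by positivity)
    _ = ∫⁻ h in ⋃ k, D k, g h := (lintegral_iUnion hDm hdisj _).symm
    _ ≤ _ := lintegral_mono_set hsub

/-- Theorem 4.1 of the paper: nondegeneracy of the transformed Boltzmann
kernel, uniformly in `v₀`. Under mass, pressure, and `q`-moment bounds (`q > 2`), for every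
`v₀ ∈ ℝⁿ`, `r > 0`, `v ∈ B₂` and unit `e`,
`∫_{B_r} K̃_f(v,v+h) (h·e)₊² dh ≥ λ r^{2-2s}`, with `λ` depending only on
`n, m₀, M₀, p₀, M_q, q, γ₀` (independent of `s` and `v₀`). -/
theorem stmt9 (n : ℕ) (hn : 2 ≤ n) (γ₀ m₀ M₀ p₀ Mq q : ℝ)
    (hγ₀ : -(n : ℝ) < γ₀) (hm₀ : 0 < m₀) (hp₀ : 0 < p₀) (hq : 2 < q) :
    ∃ lam : ℝ, 0 < lam ∧
      ∀ s γ : ℝ, s ∈ Set.Ioo (0:ℝ) 1 → -(n : ℝ) < γ → γ ≤ γ₀ →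
        ∀ f : En n → ℝ, Measurable f → (∀ v, 0 ≤ f v) →
          MassBound f m₀ M₀ → PressureLB f p₀ → MomentBound f q Mq →
          ∀ (v₀ : En n) (r : ℝ) (v e : En n), 0 < r → ‖v‖ < 2 → ‖e‖ = 1 →
            ENNReal.ofReal (lam * r ^ (2 - 2*s)) ≤
              ∫⁻ h in Metric.ball (0 : En n) r,
                KtildeE n s γ f v₀ v (v + h) * ENNReal.ofReal (max ⟪h, e⟫ 0 ^ 2) := by
  obtain ⟨m, rfl⟩ : ∃ m, n = m + 1 := ⟨n - 1, by omega⟩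
  obtain ⟨κ, c, hκ, hκ1, hc, h⟩ :=
    exists_annulus_lower m (by omega) γ₀ m₀ M₀ p₀ Mq q hm₀ hp₀ hq
  have hlog : 0 < -Real.log κ := neg_pos.2 (Real.log_neg hκ hκ1)
  refine ⟨c / 2 / (-Real.log κ), by positivity, ?_⟩
  intro s γ hs hγ hγγ₀ f hf hf0 hMass hPress hMom v₀ r v e hr hv he
  have hs1 := hs.2
  refine lintegral_ball_ge_of_annulus hκ hκ1 (by positivity) (by linarith) hr _ fun ρ hρ => ?_
  refine le_of_eq_of_le ?_ (h s γ hs hγ hγγ₀ f hf hf0 hMass hPress hMom v₀ ρ v e hρ hv he)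
  ring_nf
end
end

section
/- Let n ≥ 2 and let B : (0,∞) × [−1,1] → [0,∞] be measurable. Let f : ℝⁿ → [0,∞) and g : ℝⁿ → ℝ be measurable. Define N_f(g) := ∫_{ℝⁿ} ∫_{ℝⁿ} ∫_{S^{n-1}} (g(v) − g(v'))² f(v*) B(|v − v*|, cos θ) dσ dv* dv, where v' = (v+v*)/2 + (|v−v*|/2)σ, cos θ = ((v−v*)/|v−v*|)·σ, and the σ-integral is with respect to the surface measure on S^{n-1}. Define the kernel K_f(v, v') := 2^{n-1} |v − v'|^{−1} ∫_{{w ∈ ℝⁿ : w·(v'−v) = 0}} f(v' + w) B(r, cos θ) r^{−n+2} dw, where r² = |v − v'|² + |w|², cos θ = ((w − (v − v'))/|w − (v − v')|) · ((w − (v' − v))/|w − (v' − v)|), and the inner integral is with respect to the (n−1)-dimensional Lebesgue measure on the hyperplane through the origin orthogonal to v'−v. Then, as an identity of values in [0, ∞], N_f(g) = ∫_{ℝⁿ} ∫_{ℝⁿ} (g(v) − g(v'))² K_f(v, v') dv dv'. -/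
open MeasureTheory Metric Set
open scoped ENNReal RealInnerProductSpace NNReal

noncomputable section

/-- The collisional energy functional
`N_f(g) = ∫∫∫ (g(v)-g(v'))² f(v_*) B(|v-v_*|, cos θ) dσ dv_* dv`, where
`v' = (v+v_*)/2 + (|v-v_*|/2)σ` and `cos θ = ((v-v_*)/|v-v_*|)·σ`; the σ-integral is with
respect to the surface measure (the `(n-1)`-dimensional Hausdorff measure) on `S^{n-1}`. -/
def Nfg (n : ℕ) (B : ℝ → ℝ → ℝ≥0∞) (f g : En n → ℝ) : ℝ≥0∞ :=
  ∫⁻ v : En n, ∫⁻ vs : En n, ∫⁻ σ in Metric.sphere (0 : En n) 1,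
    ENNReal.ofReal ((g v - g ((1/2 : ℝ) • (v + vs) + (‖v - vs‖ / 2) • σ)) ^ 2) *
      ENNReal.ofReal (f vs) *
      B ‖v - vs‖ ⟪‖v - vs‖⁻¹ • (v - vs), σ⟫ ∂μH[(n:ℝ) - 1]

/-- The Boltzmann kernel in Carleman coordinates:
`K_f(v,v') = 2^{n-1} |v-v'|⁻¹ ∫_{w ⊥ v'-v} f(v'+w) B(r, cos θ) r^{-n+2} dw` with
`r² = |v-v'|² + |w|²` and
`cos θ = ((w-(v-v'))/|w-(v-v')|)·((w-(v'-v))/|w-(v'-v)|)`; the hyperplane integral is with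
respect to the `(n-1)`-dimensional Hausdorff (Lebesgue) measure. -/
def KfCarleman (n : ℕ) (B : ℝ → ℝ → ℝ≥0∞) (f : En n → ℝ) (v v' : En n) : ℝ≥0∞ :=
  ENNReal.ofReal ((2:ℝ) ^ (n - 1) / ‖v - v'‖) *
    ∫⁻ w in {w : En n | ⟪w, v' - v⟫ = 0},
      ENNReal.ofReal (f (v' + w)) *
        B (Real.sqrt (‖v - v'‖ ^ 2 + ‖w‖ ^ 2))
          ⟪‖w - (v - v')‖⁻¹ • (w - (v - v')), ‖w - (v' - v)‖⁻¹ • (w - (v' - v))⟫ *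
        ENNReal.ofReal (Real.sqrt (‖v - v'‖ ^ 2 + ‖w‖ ^ 2) ^ (-(n:ℝ) + 2)) ∂μH[(n:ℝ) - 1]

theorem measure_le_mul_of_forall_preimage_Ico_zpow {α : Type*} [MeasurableSpace α]
    {μ ν : Measure α} {f : α → ℝ≥0∞} (hf : Measurable f) (hf0 : ∀ x, f x ≠ 0)
    (hf_top : ∀ x, f x ≠ ∞) {t : ℝ≥0} (ht : 1 < t) {C : ℝ≥0∞}
    (h : ∀ (k : ℤ) (s : Set α), MeasurableSet s →
      s ⊆ f ⁻¹' Ico ((t : ℝ≥0∞) ^ k) ((t : ℝ≥0∞) ^ (k + 1)) → μ s ≤ C * ν s)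
    {s : Set α} (hs : MeasurableSet s) : μ s ≤ C * ν s := by
  have h0 : f ⁻¹' {0} = ∅ := by ext x; simp [hf0 x]
  have h1 : f ⁻¹' {∞} = ∅ := by ext x; simp [hf_top x]
  rw [measure_eq_measure_preimage_add_measure_tsum_Ico_zpow μ hf hs ht,
    measure_eq_measure_preimage_add_measure_tsum_Ico_zpow ν hf hs ht, h0, h1]
  simp only [inter_empty, measure_empty, zero_add]
  rw [← ENNReal.tsum_mul_left]
  exact ENNReal.tsum_le_tsum fun k =>
    h k _ (hs.inter (hf measurableSet_Ico)) inter_subset_right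

theorem ENNReal.le_of_forall_one_lt_le_pow_mul {x y : ℝ≥0∞} (m : ℕ)
    (h : ∀ t : ℝ≥0, 1 < t → x ≤ (t : ℝ≥0∞) ^ m * y) : x ≤ y := by
  have key : Filter.Tendsto (fun t : ℝ≥0 => (t : ℝ≥0∞) ^ m * y) (nhdsWithin 1 (Ioi 1))
      (nhds ((((1 : ℝ≥0) : ℝ≥0∞)) ^ m * y)) := by
    apply ENNReal.Tendsto.mul_const _ (Or.inl (by simp))
    refine Filter.Tendsto.mono_left ?_ nhdsWithin_le_nhds
    exact ((ENNReal.continuous_pow m).comp ENNReal.continuous_coe).tendsto 1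
  have := ge_of_tendsto key (Filter.eventually_of_mem self_mem_nhdsWithin h)
  simpa using this

theorem injective_of_dist_sq_eq {X Y : Type*} [MetricSpace X] [MetricSpace Y]
    {s : X → Y} {q : X → ℝ}
    (hs : ∀ x y, dist (s x) (s y) ^ 2 = q x * q y * dist x y ^ 2) (hq : ∀ x, 0 < q x) :
    Function.Injective s := by
  intro x y hxy
  have h := hs x y
  rw [hxy, dist_self, zero_pow two_ne_zero, eq_comm, mul_eq_zero] at h
  rcases h with h | h
  · exact absurd h (mul_pos (hq x) (hq y)).ne'
  · exact dist_eq_zero.1 (pow_eq_zero_iff two_ne_zero |>.1 h)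

section Conformal

variable {X Y : Type*} [MetricSpace X] [MeasurableSpace X] [BorelSpace X]
  [MetricSpace Y] [MeasurableSpace Y] [BorelSpace Y] {s : X → Y} {q : X → ℝ}

theorem hausdorffMeasure_image_le_of_dist_sq_eq
    (hs : ∀ x y, dist (s x) (s y) ^ 2 = q x * q y * dist x y ^ 2) (hq : ∀ x, 0 < q x)
    (m : ℕ) {A : Set X} {b : ℝ≥0} (hb : ∀ x ∈ A, q x ≤ b) :
    μH[m] (s '' A) ≤ (b : ℝ≥0∞) ^ m * μH[m] A := by
  have hL : LipschitzOnWith b s A := by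
    refine LipschitzOnWith.of_dist_le_mul fun x hx y hy => ?_
    refine abs_le_of_sq_le_sq' ?_ (by positivity) |>.2
    rw [hs, mul_pow, sq (b : ℝ)]
    have := hb x hx
    have := hb y hy
    have := (hq x).le
    have := (hq y).le
    gcongr
  simpa using hL.hausdorffMeasure_image_le (Nat.cast_nonneg m : (0 : ℝ) ≤ m)

theorem le_hausdorffMeasure_image_of_dist_sq_eq
    (hs : ∀ x y, dist (s x) (s y) ^ 2 = q x * q y * dist x y ^ 2) (hq : ∀ x, 0 < q x)
    (m : ℕ) {A : Set X} {a : ℝ≥0} (ha0 : 0 < a) (ha : ∀ x ∈ A, a ≤ q x) :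
    (a : ℝ≥0∞) ^ m * μH[m] A ≤ μH[m] (s '' A) := by
  rcases isEmpty_or_nonempty X with hX | hX
  · simp [Set.eq_empty_of_isEmpty A]
  have hinv := Function.leftInverse_invFun (injective_of_dist_sq_eq hs hq)
  have hL : LipschitzOnWith a⁻¹ (Function.invFun s) (s '' A) := by
    refine LipschitzOnWith.of_dist_le_mul ?_
    rintro _ ⟨x, hx, rfl⟩ _ ⟨y, hy, rfl⟩
    rw [hinv x, hinv y, NNReal.coe_inv, ← div_eq_inv_mul, le_div_iff₀' (by exact_mod_cast ha0)]
    refine abs_le_of_sq_le_sq' ?_ (by positivity) |>.2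
    rw [hs, mul_pow, sq (a : ℝ)]
    have := ha x hx
    have := ha y hy
    have := (hq x).le
    gcongr
  have h := hL.hausdorffMeasure_image_le (Nat.cast_nonneg m : (0 : ℝ) ≤ m)
  rw [hinv.image_image, ENNReal.rpow_natCast, ENNReal.coe_inv ha0.ne', ← ENNReal.inv_pow,
    ← ENNReal.div_eq_inv_mul, ENNReal.le_div_iff_mul_le (by simp [ha0.ne']) (by simp)] at h
  rwa [mul_comm]

/-- The area formula for a conformal map, in terms of Hausdorff measures. -/
theorem map_withDensity_hausdorffMeasure_of_dist_sq_eq (hse : MeasurableEmbedding s)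
    (hqm : Measurable q)
    (hs : ∀ x y, dist (s x) (s y) ^ 2 = q x * q y * dist x y ^ 2) (hq : ∀ x, 0 < q x)
    (m : ℕ) :
    ((μH[m] : Measure X).withDensity fun x => ENNReal.ofReal (q x) ^ m).map s =
      (μH[m] : Measure Y).restrict (range s) := by
  set ν : Measure X := (μH[m] : Measure X).withDensity fun x => ENNReal.ofReal (q x) ^ m
  set κ : Measure X := (μH[m] : Measure Y).comap s with hκ
  have hκA : ∀ A, κ A = μH[m] (s '' A) := fun A => hse.comap_apply _ A
  suffices h : ν = κ by rw [h, hκ, hse.map_comap]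
  have hf : Measurable fun x => ENNReal.ofReal (q x) := hqm.ennreal_ofReal
  have hf0 : ∀ x, ENNReal.ofReal (q x) ≠ 0 := fun x => by simpa using hq x
  have hft : ∀ x, ENNReal.ofReal (q x) ≠ ∞ := fun x => ENNReal.ofReal_ne_top
  have hbounds : ∀ t : ℝ≥0, 1 < t → ∀ (k : ℤ) (A : Set X),
      A ⊆ (fun x => ENNReal.ofReal (q x)) ⁻¹' Ico ((t : ℝ≥0∞) ^ k) ((t : ℝ≥0∞) ^ (k + 1)) →
      ∀ x ∈ A, ((t ^ k : ℝ≥0) : ℝ) ≤ q x ∧ q x ≤ ((t * t ^ k : ℝ≥0) : ℝ) := by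
    intro t ht k A hA x hx
    have ht0 : t ≠ 0 := (zero_lt_one.trans ht).ne'
    have h := hA hx
    simp only [mem_preimage, mem_Ico] at h
    rw [← ENNReal.coe_zpow ht0, ← ENNReal.coe_zpow ht0, zpow_add_one₀ ht0, mul_comm (t ^ k)] at h
    constructor
    · have := ENNReal.toReal_mono (hft x) h.1
      rwa [ENNReal.coe_toReal, ENNReal.toReal_ofReal (hq x).le] at this
    · have := ENNReal.toReal_mono ENNReal.coe_ne_top h.2.le
      rwa [ENNReal.coe_toReal, ENNReal.toReal_ofReal (hq x).le] at this
  have hνub : ∀ (b : ℝ≥0) (A : Set X), MeasurableSet A → (∀ x ∈ A, q x ≤ b) →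
      ν A ≤ (b : ℝ≥0∞) ^ m * μH[m] A := by
    intro b A hA hb
    rw [withDensity_apply _ hA, ← setLIntegral_const]
    refine setLIntegral_mono measurable_const fun x hx => ?_
    gcongr
    exact ENNReal.ofReal_le_of_le_toReal (hb x hx)
  have hνlb : ∀ (a : ℝ≥0) (A : Set X), MeasurableSet A → (∀ x ∈ A, a ≤ q x) →
      (a : ℝ≥0∞) ^ m * μH[m] A ≤ ν A := by
    intro a A hA ha
    rw [withDensity_apply _ hA, ← setLIntegral_const]
    refine setLIntegral_mono (hf.pow_const m) fun x hx => ?_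
    gcongr
    rw [← ENNReal.ofReal_coe_nnreal]
    exact ENNReal.ofReal_le_ofReal (ha x hx)
  ext A hA
  apply le_antisymm
  · refine ENNReal.le_of_forall_one_lt_le_pow_mul m fun t ht => ?_
    refine measure_le_mul_of_forall_preimage_Ico_zpow hf hf0 hft ht (fun k B hB hBk => ?_) hA
    have hb := hbounds t ht k B hBk
    calc ν B ≤ ((t * t ^ k : ℝ≥0) : ℝ≥0∞) ^ m * μH[m] B := hνub _ B hB fun x hx => (hb x hx).2
      _ = (t : ℝ≥0∞) ^ m * (((t ^ k : ℝ≥0) : ℝ≥0∞) ^ m * μH[m] B) := by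
        rw [ENNReal.coe_mul, mul_pow, mul_assoc]
      _ ≤ (t : ℝ≥0∞) ^ m * κ B := by
        rw [hκA]
        gcongr
        exact le_hausdorffMeasure_image_of_dist_sq_eq hs hq m
          (zpow_pos (zero_lt_one.trans ht) k) fun x hx => (hb x hx).1
  · refine ENNReal.le_of_forall_one_lt_le_pow_mul m fun t ht => ?_
    refine measure_le_mul_of_forall_preimage_Ico_zpow hf hf0 hft ht (fun k B hB hBk => ?_) hA
    have hb := hbounds t ht k B hBk
    calc κ B ≤ ((t * t ^ k : ℝ≥0) : ℝ≥0∞) ^ m * μH[m] B := by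
          rw [hκA]
          exact hausdorffMeasure_image_le_of_dist_sq_eq hs hq m fun x hx => (hb x hx).2
      _ = (t : ℝ≥0∞) ^ m * (((t ^ k : ℝ≥0) : ℝ≥0∞) ^ m * μH[m] B) := by
        rw [ENNReal.coe_mul, mul_pow, mul_assoc]
      _ ≤ (t : ℝ≥0∞) ^ m * ν B := by
        gcongr
        exact hνlb _ B hB fun x hx => (hb x hx).1

end Conformal

/-- The first vector of the canonical basis. -/
def firstVec (m : ℕ) : En (m + 1) := EuclideanSpace.single 0 1

/-- The isometric inclusion of `ℝᵐ` in `ℝᵐ⁺¹` as the hyperplane orthogonal to `firstVec m`. -/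
def hyperplaneIncl (m : ℕ) : En m →ₗᵢ[ℝ] En (m + 1) where
  toFun t := WithLp.toLp 2 (Fin.cons 0 t.ofLp)
  map_add' s t := by
    ext i
    refine Fin.cases ?_ (fun j => ?_) i <;> simp
  map_smul' c t := by
    ext i
    refine Fin.cases ?_ (fun j => ?_) i <;> simp
  norm_map' t := by
    simp [EuclideanSpace.norm_eq, Fin.sum_univ_succ]

/-- The hyperplane reflection exchanging `firstVec m` and the direction of `x`. -/
def rotTo {m : ℕ} (x : En (m + 1)) : En (m + 1) ≃ₗᵢ[ℝ] En (m + 1) :=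
  (ℝ ∙ (firstVec m - ‖x‖⁻¹ • x))ᗮ.reflection

/-- A linear isometry from `ℝᵐ` onto the orthogonal of `x`, depending measurably on `x`. -/
def perpIso {m : ℕ} (x : En (m + 1)) : En m →ₗᵢ[ℝ] En (m + 1) :=
  (rotTo x).toLinearIsometry.comp (hyperplaneIncl m)

theorem norm_firstVec (m : ℕ) : ‖firstVec m‖ = 1 := by simp [firstVec]

theorem norm_inv_norm_smul {m : ℕ} {x : En m} (hx : x ≠ 0) : ‖‖x‖⁻¹ • x‖ = 1 := by
  rw [norm_smul, norm_inv, norm_norm, inv_mul_cancel₀ (norm_ne_zero_iff.2 hx)]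

theorem rotTo_firstVec {m : ℕ} {x : En (m + 1)} (hx : x ≠ 0) :
    rotTo x (firstVec m) = ‖x‖⁻¹ • x :=
  Submodule.reflection_sub (by rw [norm_firstVec, norm_inv_norm_smul hx])

theorem inner_hyperplaneIncl_firstVec {m : ℕ} (t : En m) :
    ⟪hyperplaneIncl m t, firstVec m⟫ = 0 := by
  simp [firstVec, hyperplaneIncl, EuclideanSpace.inner_single_right]

theorem inner_perpIso_direction {m : ℕ} {x : En (m + 1)} (hx : x ≠ 0) (t : En m) :
    ⟪perpIso x t, ‖x‖⁻¹ • x⟫ = 0 := by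
  rw [← rotTo_firstVec hx]
  exact ((rotTo x).inner_map_map _ _).trans (inner_hyperplaneIncl_firstVec t)

theorem inner_perpIso {m : ℕ} (x : En (m + 1)) (t : En m) : ⟪perpIso x t, x⟫ = 0 := by
  rcases eq_or_ne x 0 with rfl | hx
  · simp
  have h := inner_perpIso_direction hx t
  rw [inner_smul_right, mul_eq_zero] at h
  exact h.resolve_left (inv_ne_zero (norm_ne_zero_iff.2 hx))

theorem perpIso_smul {m : ℕ} {c : ℝ} (hc : 0 < c) (x : En (m + 1)) :
    perpIso (c • x) = perpIso x := by
  have : ‖c • x‖⁻¹ • c • x = ‖x‖⁻¹ • x := by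
    rw [norm_smul, Real.norm_of_nonneg hc.le, smul_smul, mul_inv, mul_right_comm,
      inv_mul_cancel₀ hc.ne', one_mul]
  simp only [perpIso, rotTo, this]

theorem range_hyperplaneIncl (m : ℕ) :
    range (hyperplaneIncl m) = {w | ⟪w, firstVec m⟫ = 0} := by
  ext w
  constructor
  · rintro ⟨t, rfl⟩
    exact inner_hyperplaneIncl_firstVec t
  · intro h
    refine ⟨WithLp.toLp 2 (Fin.tail w.ofLp), ?_⟩
    have h0 : w 0 = 0 := by
      simpa [firstVec, EuclideanSpace.inner_single_right] using h
    ext i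
    refine Fin.cases ?_ (fun j => ?_) i
    · simp [hyperplaneIncl, h0]
    · simp [hyperplaneIncl, Fin.tail]

theorem range_perpIso {m : ℕ} {x : En (m + 1)} (hx : x ≠ 0) :
    range (perpIso x) = {w | ⟪w, x⟫ = 0} := by
  apply Subset.antisymm
  · rintro _ ⟨t, rfl⟩
    exact inner_perpIso x t
  · intro w hw
    have h : (rotTo x).symm w ∈ range (hyperplaneIncl m) := by
      rw [range_hyperplaneIncl]
      change ⟪(rotTo x).symm w, firstVec m⟫ = 0
      rw [← (rotTo x).inner_map_map, LinearIsometryEquiv.apply_symm_apply, rotTo_firstVec hx,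
        inner_smul_right, show ⟪w, x⟫ = 0 from hw, mul_zero]
    obtain ⟨t, ht⟩ := h
    exact ⟨t, by simp [perpIso, ht]⟩

theorem measurable_perpIso {m : ℕ} :
    Measurable fun p : En (m + 1) × En m => perpIso p.1 p.2 := by
  have h : ∀ p : En (m + 1) × En m, perpIso p.1 p.2 =
      -((2 : ℕ) • (⟪firstVec m - ‖p.1‖⁻¹ • p.1, hyperplaneIncl m p.2⟫ /
        ‖firstVec m - ‖p.1‖⁻¹ • p.1‖ ^ 2) • (firstVec m - ‖p.1‖⁻¹ • p.1) -
        hyperplaneIncl m p.2) := by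
    intro p
    change (ℝ ∙ (firstVec m - ‖p.1‖⁻¹ • p.1))ᗮ.reflection (hyperplaneIncl m p.2) = _
    rw [Submodule.reflection_orthogonal_apply, Submodule.reflection_singleton_apply]
    rfl
  have hι : Measurable fun p : En (m + 1) × En m => hyperplaneIncl m p.2 :=
    (hyperplaneIncl m).continuous.measurable.comp measurable_snd
  simp_rw [h]
  fun_prop

theorem norm_smul_add_perpIso_sq {m : ℕ} {x : En (m + 1)} (hx : x ≠ 0) (a : ℝ) (t : En m) :
    ‖a • (‖x‖⁻¹ • x) + perpIso x t‖ ^ 2 = a ^ 2 + ‖t‖ ^ 2 := by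
  rw [norm_add_sq_real, norm_smul a, norm_inv_norm_smul hx, real_inner_comm, inner_smul_right,
    inner_perpIso_direction hx, (perpIso x).norm_map]
  simp

/-- Fubini's theorem in orthonormal coordinates adapted to the direction of `x`. -/
theorem lintegral_smul_add_perpIso {m : ℕ} {x : En (m + 1)} (hx : x ≠ 0)
    {φ : En (m + 1) → ℝ≥0∞} (hφ : Measurable φ) :
    ∫⁻ a : ℝ, ∫⁻ t : En m, φ (a • (‖x‖⁻¹ • x) + perpIso x t) = ∫⁻ y, φ y := by
  have hmp : MeasurePreserving
      (fun p : ℝ × En m => (p.1 • firstVec m + hyperplaneIncl m p.2 : En (m + 1)))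
      (volume.prod volume) volume := by
    have h1 : MeasurePreserving (Prod.map id (WithLp.ofLp : En m → Fin m → ℝ))
        ((volume : Measure ℝ).prod volume) (volume.prod volume) :=
      (MeasurePreserving.id _).prod (PiLp.volume_preserving_ofLp (Fin m))
    have h2 := (volume_preserving_piFinSuccAbove (fun _ : Fin (m + 1) => ℝ) 0).symm
    have h3 := PiLp.volume_preserving_toLp (Fin (m + 1))
    have h4 : (fun p : ℝ × En m => (p.1 • firstVec m + hyperplaneIncl m p.2 : En (m + 1))) =
        WithLp.toLp 2 ∘ (MeasurableEquiv.piFinSuccAbove (fun _ : Fin (m + 1) => ℝ) 0).symm ∘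
          Prod.map id WithLp.ofLp := by
      funext p
      ext i
      refine Fin.cases ?_ (fun j => ?_) i <;> simp [firstVec, hyperplaneIncl]
    rw [h4]
    exact h3.comp (h2.comp h1)
  have hrot := (rotTo x).measurePreserving
  have := (hrot.comp hmp).lintegral_comp hφ
  rw [← this, lintegral_prod]
  · simp [rotTo_firstVec hx, perpIso]
  · exact (hφ.comp (hrot.comp hmp).measurable).aemeasurable

/-- The constant relating the Hausdorff measure to the Lebesgue measure. -/
def hausdorffConst (m : ℕ) : ℝ≥0 :=
  Measure.addHaarScalarFactor (μH[m] : Measure (En m)) volume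

theorem hausdorffMeasure_eq_smul_volume (m : ℕ) :
    (μH[m] : Measure (En m)) = hausdorffConst m • volume :=
  Measure.isAddLeftInvariant_eq_smul _ _

theorem lintegral_hausdorffMeasure_eq (m : ℕ) (φ : En m → ℝ≥0∞) :
    ∫⁻ t, φ t ∂μH[m] = hausdorffConst m * ∫⁻ t, φ t := by
  rw [hausdorffMeasure_eq_smul_volume, lintegral_smul_measure]
  rfl

theorem setLIntegral_hausdorffMeasure_orthogonal {m : ℕ} {x : En (m + 1)} (hx : x ≠ 0)
    (φ : En (m + 1) → ℝ≥0∞) :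
    ∫⁻ w in {w | ⟪w, x⟫ = 0}, φ w ∂μH[m] = hausdorffConst m * ∫⁻ t, φ (perpIso x t) := by
  rw [← range_perpIso hx, ← (perpIso x).isometry.map_hausdorffMeasure (Or.inl m.cast_nonneg),
    (perpIso x).isometry.isClosedEmbedding.measurableEmbedding.lintegral_map,
    lintegral_hausdorffMeasure_eq]

/-- Inverse stereographic projection from the pole opposite to the direction of `e`. -/
def stereoInv {m : ℕ} (e : En (m + 1)) (t : En m) : En (m + 1) :=
  (2 / (1 + ‖t‖ ^ 2)) • (‖e‖⁻¹ • e + perpIso e t) - ‖e‖⁻¹ • e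

theorem norm_direction_add_perpIso_sq {m : ℕ} {e : En (m + 1)} (he : e ≠ 0) (t : En m) :
    ‖‖e‖⁻¹ • e + perpIso e t‖ ^ 2 = 1 + ‖t‖ ^ 2 := by
  simpa using norm_smul_add_perpIso_sq he 1 t

theorem dist_stereoInv_sq {m : ℕ} {e : En (m + 1)} (he : e ≠ 0) (t t' : En m) :
    dist (stereoInv e t) (stereoInv e t') ^ 2 =
      (2 / (1 + ‖t‖ ^ 2)) * (2 / (1 + ‖t'‖ ^ 2)) * dist t t' ^ 2 := by
  have h1 := norm_direction_add_perpIso_sq he t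
  have h2 := norm_direction_add_perpIso_sq he t'
  have h3 : dist t t' ^ 2 =
      ‖(‖e‖⁻¹ • e + perpIso e t) - (‖e‖⁻¹ • e + perpIso e t')‖ ^ 2 := by
    rw [add_sub_add_left_eq_sub, ← map_sub, (perpIso e).norm_map, dist_eq_norm]
  rw [h3, dist_eq_norm, stereoInv, stereoInv, sub_sub_sub_cancel_right, norm_sub_sq_real,
    norm_sub_sq_real, norm_smul, norm_smul, mul_pow, mul_pow, h1, h2, inner_smul_left,
    inner_smul_right, Real.norm_eq_abs, Real.norm_eq_abs, sq_abs, sq_abs]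
  simp only [conj_trivial]
  have : 1 + ‖t‖ ^ 2 ≠ 0 := by positivity
  have : 1 + ‖t'‖ ^ 2 ≠ 0 := by positivity
  field_simp
  ring

theorem norm_stereoInv {m : ℕ} {e : En (m + 1)} (he : e ≠ 0) (t : En m) :
    ‖stereoInv e t‖ = 1 := by
  have h1 := norm_direction_add_perpIso_sq he t
  have h2 : ⟪‖e‖⁻¹ • e + perpIso e t, ‖e‖⁻¹ • e⟫ = 1 := by
    rw [inner_add_left, inner_perpIso_direction he, real_inner_self_eq_norm_sq,
      norm_inv_norm_smul he]
    norm_num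
  have h3 : ‖stereoInv e t‖ ^ 2 = 1 := by
    rw [stereoInv, norm_sub_sq_real, norm_smul, mul_pow, h1, inner_smul_left, h2,
      norm_inv_norm_smul he, Real.norm_eq_abs, sq_abs]
    have : 1 + ‖t‖ ^ 2 ≠ 0 := by positivity
    simp only [conj_trivial]
    field_simp
    ring
  exact (pow_eq_one_iff_of_nonneg (norm_nonneg _) two_ne_zero).1 h3

theorem mem_range_stereoInv {m : ℕ} {e : En (m + 1)} (he : e ≠ 0) {σ : En (m + 1)}
    (hσ : ‖σ‖ = 1) (hne : σ ≠ -(‖e‖⁻¹ • e)) : σ ∈ range (stereoInv e) := by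
  set d := ‖e‖⁻¹ • e with hd
  have hd1 : ‖d‖ = 1 := norm_inv_norm_smul he
  have hN : ‖d + σ‖ ^ 2 = 2 * (1 + ⟪σ, d⟫) := by
    rw [norm_add_sq_real, hd1, hσ, real_inner_comm]
    ring
  have hN0 : ‖d + σ‖ ≠ 0 := by
    rw [norm_ne_zero_iff]
    intro h
    exact hne (eq_neg_of_add_eq_zero_right h)
  have hdd : ⟪d, d⟫ = 1 := by rw [real_inner_self_eq_norm_sq, hd1, one_pow]
  have hperp : (2 / ‖d + σ‖ ^ 2) • (d + σ) - d ∈ {w | ⟪w, e⟫ = 0} := by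
    have h1 : ⟪(2 / ‖d + σ‖ ^ 2) • (d + σ) - d, d⟫ = 0 := by
      rw [inner_sub_left, inner_smul_left, inner_add_left, hdd]
      simp only [conj_trivial]
      rw [div_mul_eq_mul_div, ← hN, div_self (pow_ne_zero 2 hN0), sub_self]
    rw [hd, inner_smul_right, mul_eq_zero] at h1
    exact h1.resolve_left (inv_ne_zero (norm_ne_zero_iff.2 he))
  rw [← range_perpIso he] at hperp
  obtain ⟨t, ht⟩ := hperp
  have hp : d + perpIso e t = (2 / ‖d + σ‖ ^ 2) • (d + σ) := by rw [ht]; abel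
  have ht2 : 1 + ‖t‖ ^ 2 = 4 / ‖d + σ‖ ^ 2 := by
    rw [← norm_direction_add_perpIso_sq he t, ← hd, hp, norm_smul, mul_pow, Real.norm_eq_abs,
      sq_abs]
    field_simp
    norm_num
  refine ⟨t, ?_⟩
  rw [stereoInv, ← hd, hp, ht2, smul_smul]
  have : 2 / (4 / ‖d + σ‖ ^ 2) * (2 / ‖d + σ‖ ^ 2) = 1 := by
    field_simp
    norm_num
  rw [this, one_smul, add_sub_cancel_left]

theorem continuous_stereoInv {m : ℕ} (e : En (m + 1)) : Continuous (stereoInv e) := by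
  have h := (perpIso e).continuous
  unfold stereoInv
  fun_prop (disch := intro x; positivity)

/-- Integration over the unit sphere in stereographic coordinates. -/
theorem setLIntegral_sphere_eq_stereoInv {m : ℕ} (hm : 1 ≤ m) {e : En (m + 1)} (he : e ≠ 0)
    {φ : En (m + 1) → ℝ≥0∞} (hφ : Measurable φ) :
    ∫⁻ σ in Metric.sphere (0 : En (m + 1)) 1, φ σ ∂μH[m] =
      hausdorffConst m *
        ∫⁻ t, ENNReal.ofReal (2 / (1 + ‖t‖ ^ 2)) ^ m * φ (stereoInv e t) := by
  have hq : ∀ t : En m, 0 < 2 / (1 + ‖t‖ ^ 2) := fun t => by positivity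
  have hqm : Measurable fun t : En m => 2 / (1 + ‖t‖ ^ 2) := by fun_prop
  have hd := dist_stereoInv_sq he
  have hse : MeasurableEmbedding (stereoInv e) :=
    (continuous_stereoInv e).measurableEmbedding (injective_of_dist_sq_eq hd hq)
  have hae : (Metric.sphere (0 : En (m + 1)) 1 : Set (En (m + 1))) =ᵐ[μH[m]]
      range (stereoInv e) := by
    have : NullSingletonClass (μH[m] : Measure (En (m + 1))) :=
      Measure.nullSingletonClass_hausdorff _ (by exact_mod_cast hm)
    have hnull : ∀ᵐ σ ∂(μH[m] : Measure (En (m + 1))), σ ≠ -(‖e‖⁻¹ • e) := by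
      simp [ae_iff]
    filter_upwards [hnull] with σ hσ
    refine propext ⟨fun h => mem_range_stereoInv he (mem_sphere_zero_iff_norm.1 h) hσ, ?_⟩
    rintro ⟨t, rfl⟩
    exact mem_sphere_zero_iff_norm.2 (norm_stereoInv he t)
  rw [setLIntegral_congr hae, ← map_withDensity_hausdorffMeasure_of_dist_sq_eq hse hqm hd hq m,
    hse.lintegral_map, lintegral_withDensity_eq_lintegral_mul _ (hqm.ennreal_ofReal.pow_const m)
      (show Measurable fun t => φ (stereoInv e t) from hφ.comp hse.measurable),
    lintegral_hausdorffMeasure_eq]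
  rfl

theorem lintegral_eq_mul_lintegral_comp_smul {E : Type*} [NormedAddCommGroup E]
    [NormedSpace ℝ E] [FiniteDimensional ℝ E] [MeasurableSpace E] [BorelSpace E]
    (μ : Measure E) [μ.IsAddHaarMeasure] {c : ℝ} (hc : 0 < c) (φ : E → ℝ≥0∞) :
    ∫⁻ x, φ x ∂μ = ENNReal.ofReal (c ^ Module.finrank ℝ E) * ∫⁻ y, φ (c • y) ∂μ := by
  have hemb : MeasurableEmbedding (fun y : E => c • y) :=
    (Homeomorph.smulOfNeZero c hc.ne').measurableEmbedding
  have hpos : 0 < c ^ Module.finrank ℝ E := pow_pos hc _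
  rw [← hemb.lintegral_map, Measure.map_addHaar_smul μ hc.ne', lintegral_smul_measure,
    abs_of_pos (inv_pos.2 hpos), smul_eq_mul, ← mul_assoc, ← ENNReal.ofReal_mul hpos.le,
    mul_inv_cancel₀ hpos.ne', ENNReal.ofReal_one, one_mul]

/-- The function `ρ ↦ ρ₊ᵐ`, with value `0` for `ρ ≤ 0`. -/
def posPow (m : ℕ) (ρ : ℝ) : ℝ≥0∞ := if 0 < ρ then ENNReal.ofReal (ρ ^ m) else 0

theorem measurable_posPow (m : ℕ) : Measurable (posPow m) :=
  Measurable.ite measurableSet_Ioi (by fun_prop) measurable_const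

theorem lintegral_Ioi_ofReal_div_sq {a : ℝ} (ha : 0 < a) :
    ∫⁻ ρ in Ioi a, ENNReal.ofReal (a / ρ ^ 2) = 1 := by
  have hcongr : ∀ ρ ∈ Ioi a, a / ρ ^ 2 = a * ρ ^ (-2 : ℝ) := by
    intro ρ hρ
    have hρ0 : 0 < ρ := ha.trans hρ
    rw [Real.rpow_neg hρ0.le, Real.rpow_ofNat, div_eq_mul_inv]
  have hint : IntegrableOn (fun ρ : ℝ => a * ρ ^ (-2 : ℝ)) (Ioi a) :=
    (integrableOn_Ioi_rpow_of_lt (by norm_num) ha).const_mul a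
  rw [setLIntegral_congr_fun measurableSet_Ioi (fun ρ hρ => by rw [hcongr ρ hρ]),
    ← ofReal_integral_eq_lintegral_ofReal hint, integral_const_mul,
    integral_Ioi_rpow_of_lt (by norm_num) ha]
  · rw [show (-2 : ℝ) + 1 = -1 by norm_num, Real.rpow_neg_one]
    field_simp
    norm_num
  · filter_upwards [ae_restrict_mem measurableSet_Ioi] with ρ hρ
    have hρ0 : 0 < ρ := ha.trans hρ
    positivity

theorem lintegral_eq_lintegral_ball_radial {m : ℕ} {ψ : En (m + 1) → ℝ≥0∞}
    (hψ : Measurable ψ) :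
    ∫⁻ x, ψ x = ∫⁻ y in ball (0 : En (m + 1)) 1, ∫⁻ ρ : ℝ,
      posPow m ρ * (ENNReal.ofReal ‖y‖ * ψ (ρ • y)) := by
  have hw := measurable_posPow m
  set k : ℝ → En (m + 1) → ℝ≥0∞ := fun ρ x =>
    if ‖x‖ < ρ then ENNReal.ofReal (‖x‖ / ρ ^ 2) else 0 with hk
  have hkm : Measurable fun p : ℝ × En (m + 1) => k p.1 p.2 :=
    Measurable.ite (measurableSet_lt (by fun_prop) (by fun_prop)) (by fun_prop) measurable_const
  have hslice : ∀ ρ : ℝ, ∫⁻ y in ball (0 : En (m + 1)) 1,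
      posPow m ρ * (ENNReal.ofReal ‖y‖ * ψ (ρ • y)) = ∫⁻ x, k ρ x * ψ x := by
    intro ρ
    rcases le_or_gt ρ 0 with hρ | hρ
    · have h1 : ∀ x, k ρ x = 0 := fun x =>
        if_neg (not_lt.2 (hρ.trans (norm_nonneg x)))
      simp [h1, posPow, not_lt.2 hρ]
    · rw [lintegral_eq_mul_lintegral_comp_smul volume hρ, ← lintegral_const_mul' _ _ (by simp),
        ← lintegral_indicator measurableSet_ball]
      congr 1 with y
      have hkρ : k ρ (ρ • y) = if ‖y‖ < 1 then ENNReal.ofReal (‖y‖ / ρ) else 0 := by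
        simp only [hk, norm_smul, Real.norm_of_nonneg hρ.le]
        have e1 : ρ * ‖y‖ < ρ ↔ ‖y‖ < 1 := by
          rw [mul_lt_iff_lt_one_right hρ]
        have e2 : ρ * ‖y‖ / ρ ^ 2 = ‖y‖ / ρ := by field_simp
        simp only [e1, e2]
      rw [hkρ]
      by_cases hy : ‖y‖ < 1
      · rw [indicator_of_mem (by simpa using hy), if_pos hy, posPow, if_pos hρ, ← mul_assoc,
          ← mul_assoc, ← ENNReal.ofReal_mul (by positivity), ← ENNReal.ofReal_mul (by positivity)]
        congr 2
        simp only [finrank_euclideanSpace, Fintype.card_fin]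
        field_simp
        ring
      · rw [indicator_of_notMem (by simpa using hy), if_neg hy]
        simp
  rw [lintegral_lintegral_swap, lintegral_congr hslice, lintegral_lintegral_swap]
  · refine lintegral_congr_ae ?_
    filter_upwards [Measure.ae_ne volume (0 : En (m + 1))] with x hx
    rw [lintegral_mul_const _ (by fun_prop)]
    have : ∫⁻ ρ, k ρ x = ∫⁻ ρ in Ioi ‖x‖, ENNReal.ofReal (‖x‖ / ρ ^ 2) := by
      rw [← lintegral_indicator measurableSet_Ioi]
      rfl
    rw [this, lintegral_Ioi_ofReal_div_sq (norm_pos_iff.2 hx), one_mul]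
  · exact (hkm.mul (hψ.comp measurable_snd)).aemeasurable
  · apply Measurable.aemeasurable
    simp only [Function.uncurry_def]
    fun_prop

theorem lintegral_ray_perpIso {m : ℕ} {Q : En (m + 1) × En (m + 1) → ℝ≥0∞}
    (hQ : Measurable Q) {y : En (m + 1)} (hy : y ≠ 0) :
    ∫⁻ ρ : ℝ, posPow m ρ * (ENNReal.ofReal ‖y‖ *
        ∫⁻ t : En m, Q (ρ • y, ρ • y + perpIso (ρ • y) t)) =
      ∫⁻ u, posPow m (⟪u, y⟫ / ‖y‖ ^ 2) * Q ((⟪u, y⟫ / ‖y‖ ^ 2) • y, u) := by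
  have hw := measurable_posPow m
  have hy0 : 0 < ‖y‖ := norm_pos_iff.2 hy
  rw [← lintegral_smul_add_perpIso hy (by fun_prop)]
  symm
  rw [lintegral_eq_mul_lintegral_comp_smul volume hy0, ← lintegral_const_mul' _ _ (by simp)]
  congr 1 with ρ
  have hin : ∀ t, ⟪(‖y‖ • ρ) • (‖y‖⁻¹ • y) + perpIso y t, y⟫ / ‖y‖ ^ 2 = ρ := by
    intro t
    rw [inner_add_left, inner_perpIso, smul_smul, inner_smul_left, real_inner_self_eq_norm_sq]
    simp only [conj_trivial, smul_eq_mul]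
    field_simp
    ring
  have hsm : (‖y‖ • ρ) • (‖y‖⁻¹ • y) = ρ • y := by
    rw [smul_smul, smul_eq_mul]
    congr 1
    field_simp
  simp only [hin]
  simp only [hsm]
  have hm1 : Measurable fun t => Q (ρ • y, ρ • y + perpIso y t) := by
    have := (perpIso y).continuous.measurable
    fun_prop
  rw [lintegral_const_mul _ hm1]
  rcases le_or_gt ρ 0 with hρ | hρ
  · simp [posPow, not_lt.2 hρ]
  · rw [perpIso_smul hρ]
    simp only [Module.finrank_self, pow_one]
    ring

/-- The point of the sphere of diameter `[0, u]` seen from `0` in the direction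
`u / ‖u‖ + perpIso u t`. -/
def thalesPt {m : ℕ} (u : En (m + 1)) (t : En m) : En (m + 1) :=
  (‖u‖ / (1 + ‖t‖ ^ 2)) • (‖u‖⁻¹ • u + perpIso u t)

theorem measurable_thalesPt {m : ℕ} :
    Measurable fun p : En (m + 1) × En m => thalesPt p.1 p.2 := by
  have := measurable_perpIso (m := m)
  unfold thalesPt
  fun_prop

theorem lintegral_ball_indicator_slice {m : ℕ} (Q : En (m + 1) × En (m + 1) → ℝ≥0∞)
    {u : En (m + 1)} (hu : u ≠ 0) (a : ℝ) :
    ∫⁻ t : En m, (ball (0 : En (m + 1)) 1).indicator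
      (fun y => posPow m (⟪u, y⟫ / ‖y‖ ^ 2) * Q ((⟪u, y⟫ / ‖y‖ ^ 2) • y, u))
        (a • (‖u‖⁻¹ • u) + perpIso u t) =
      ∫⁻ t : En m, (if 0 < a ∧ a < (√(1 + ‖t‖ ^ 2))⁻¹ then 1 else 0) *
        (ENNReal.ofReal ((‖u‖ / (1 + ‖t‖ ^ 2)) ^ m) * Q (thalesPt u t, u)) := by
  have hu0 : 0 < ‖u‖ := norm_pos_iff.2 hu
  have hin : ∀ t, ⟪u, a • (‖u‖⁻¹ • u) + perpIso u t⟫ = a * ‖u‖ := by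
    intro t
    rw [inner_add_right, real_inner_comm, real_inner_comm (perpIso u t), inner_perpIso,
      smul_smul, inner_smul_left, real_inner_self_eq_norm_sq]
    simp only [conj_trivial]
    field_simp
    ring
  rcases le_or_gt a 0 with ha | ha
  · have h0 : ∀ t : En m, posPow m (a * ‖u‖ / (a ^ 2 + ‖t‖ ^ 2)) = 0 := fun t =>
      if_neg (not_lt.2 (div_nonpos_of_nonpos_of_nonneg
        (mul_nonpos_of_nonpos_of_nonneg ha hu0.le) (by positivity)))
    simp only [indicator, hin, norm_smul_add_perpIso_sq hu, h0, not_lt.2 ha]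
    simp
  · rw [lintegral_eq_mul_lintegral_comp_smul volume ha, ← lintegral_const_mul' _ _ (by simp)]
    congr 1 with t
    have hmem : a • (‖u‖⁻¹ • u) + perpIso u (a • t) ∈ ball (0 : En (m + 1)) 1 ↔
        0 < a ∧ a < (√(1 + ‖t‖ ^ 2))⁻¹ := by
      have h1 : 0 < √(1 + ‖t‖ ^ 2) := by positivity
      have h2 : √(1 + ‖t‖ ^ 2) ^ 2 = 1 + ‖t‖ ^ 2 := Real.sq_sqrt (by positivity)
      rw [mem_ball_zero_iff, ← sq_lt_one_iff₀ (norm_nonneg _), norm_smul_add_perpIso_sq hu,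
        norm_smul, Real.norm_of_nonneg ha.le, and_iff_right ha, ← one_div, lt_div_iff₀ h1,
        ← sq_lt_one_iff₀ (a := a * √(1 + ‖t‖ ^ 2)) (by positivity), mul_pow, mul_pow, h2]
      ring_nf
    by_cases h : 0 < a ∧ a < (√(1 + ‖t‖ ^ 2))⁻¹
    · rw [indicator_of_mem (hmem.2 h), if_pos h, one_mul, hin, norm_smul_add_perpIso_sq hu,
        norm_smul, Real.norm_of_nonneg ha.le]
      have hρ : a * ‖u‖ / (a ^ 2 + (a * ‖t‖) ^ 2) = a⁻¹ * (‖u‖ / (1 + ‖t‖ ^ 2)) := by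
        field_simp
      have hpt : (a⁻¹ * (‖u‖ / (1 + ‖t‖ ^ 2))) • (a • (‖u‖⁻¹ • u) + perpIso u (a • t)) =
          thalesPt u t := by
        rw [map_smul, ← smul_add, smul_smul, thalesPt]
        congr 1
        field_simp
      have hρ0 : 0 < a⁻¹ * (‖u‖ / (1 + ‖t‖ ^ 2)) := by positivity
      rw [hρ, hpt, posPow, if_pos hρ0, ← mul_assoc, ← ENNReal.ofReal_mul (by positivity)]
      congr 2
      rw [finrank_euclideanSpace, Fintype.card_fin, mul_pow, ← mul_assoc, ← mul_pow,
        mul_inv_cancel₀ ha.ne', one_pow, one_mul]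
    · rw [indicator_of_notMem (fun h' => h (hmem.1 h')), if_neg h, mul_zero, zero_mul]

theorem lintegral_ball_thalesPt {m : ℕ} {Q : En (m + 1) × En (m + 1) → ℝ≥0∞}
    (hQ : Measurable Q) {u : En (m + 1)} (hu : u ≠ 0) :
    ∫⁻ y in ball (0 : En (m + 1)) 1,
        posPow m (⟪u, y⟫ / ‖y‖ ^ 2) * Q ((⟪u, y⟫ / ‖y‖ ^ 2) • y, u) =
      ∫⁻ t : En m, ENNReal.ofReal ((√(1 + ‖t‖ ^ 2))⁻¹ * (‖u‖ / (1 + ‖t‖ ^ 2)) ^ m) *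
        Q (thalesPt u t, u) := by
  have hw := measurable_posPow m
  have hX : Measurable fun t : En m => thalesPt u t := by
    have h := measurable_thalesPt.comp (measurable_prodMk_left (x := u) (β := En m))
    exact h
  rw [← lintegral_indicator measurableSet_ball, ← lintegral_smul_add_perpIso hu
    (Measurable.indicator (by fun_prop) measurableSet_ball), lintegral_congr (lintegral_ball_indicator_slice Q hu),
    lintegral_lintegral_swap]
  · congr 1 with t
    have hset : ∀ a : ℝ, (if 0 < a ∧ a < (√(1 + ‖t‖ ^ 2))⁻¹ then (1 : ℝ≥0∞) else 0) =
        (Ioo 0 (√(1 + ‖t‖ ^ 2))⁻¹).indicator 1 a := fun a => by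
      simp [indicator]
    simp only [hset]
    rw [lintegral_mul_const _ (measurable_one.indicator measurableSet_Ioo),
      lintegral_indicator_one measurableSet_Ioo, Real.volume_Ioo, sub_zero, ← mul_assoc,
      ← ENNReal.ofReal_mul (by positivity)]
  · apply Measurable.aemeasurable
    simp only [Function.uncurry_def]
    refine Measurable.mul (Measurable.ite ?_ measurable_const measurable_const) (by fun_prop)
    have hs1 : MeasurableSet {p : ℝ × En m | 0 < p.1} :=
      measurableSet_lt (by fun_prop) (by fun_prop)
    have hs2 : MeasurableSet {p : ℝ × En m | p.1 < (√(1 + ‖p.2‖ ^ 2))⁻¹} :=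
      measurableSet_lt (by fun_prop) (by fun_prop)
    exact hs1.inter hs2

theorem lintegral_perpIso_eq_lintegral_thalesPt {m : ℕ}
    {Q : En (m + 1) × En (m + 1) → ℝ≥0∞} (hQ : Measurable Q) :
    ∫⁻ x, ∫⁻ t, Q (x, x + perpIso x t) =
      ∫⁻ u : En (m + 1), ∫⁻ t : En m,
        ENNReal.ofReal ((√(1 + ‖t‖ ^ 2))⁻¹ * (‖u‖ / (1 + ‖t‖ ^ 2)) ^ m) *
          Q (thalesPt u t, u) := by
  have hw := measurable_posPow m
  have hp := measurable_perpIso (m := m)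
  have h1 : Measurable fun x => ∫⁻ t, Q (x, x + perpIso x t) := by
    apply Measurable.lintegral_prod_right'
      (f := fun p : En (m + 1) × En m => Q (p.1, p.1 + perpIso p.1 p.2))
    fun_prop
  rw [lintegral_eq_lintegral_ball_radial h1]
  have h2 : ∀ᵐ y ∂(volume.restrict (ball (0 : En (m + 1)) 1)), y ≠ 0 :=
    ae_restrict_of_ae (Measure.ae_ne volume 0)
  rw [lintegral_congr_ae (h2.mono fun y hy => lintegral_ray_perpIso hQ hy),
    lintegral_lintegral_swap]
  · refine lintegral_congr_ae ?_
    filter_upwards [Measure.ae_ne volume (0 : En (m + 1))] with u hu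
    exact lintegral_ball_thalesPt hQ hu
  · apply Measurable.aemeasurable
    simp only [Function.uncurry_def]
    fun_prop

theorem norm_thalesPt {m : ℕ} {u : En (m + 1)} (hu : u ≠ 0) (t : En m) :
    ‖thalesPt u t‖ = ‖u‖ * (√(1 + ‖t‖ ^ 2))⁻¹ := by
  have h1 : ‖‖u‖⁻¹ • u + perpIso u t‖ = √(1 + ‖t‖ ^ 2) := by
    rw [← norm_direction_add_perpIso_sq hu, Real.sqrt_sq (norm_nonneg _)]
  have h2 : √(1 + ‖t‖ ^ 2) ^ 2 = 1 + ‖t‖ ^ 2 := Real.sq_sqrt (by positivity)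
  have h3 : 0 < √(1 + ‖t‖ ^ 2) := by positivity
  rw [thalesPt, norm_smul, h1, Real.norm_of_nonneg (by positivity), ← h2]
  field_simp
  rw [Real.sqrt_sq h3.le]

theorem smul_add_smul_stereoInv {m : ℕ} {u : En (m + 1)} (hu : u ≠ 0) (t : En m) :
    (1 / 2 : ℝ) • u + (‖u‖ / 2) • stereoInv u t = thalesPt u t := by
  have hu0 : ‖u‖ ≠ 0 := norm_ne_zero_iff.2 hu
  have h : (‖u‖ / 2) • (‖u‖⁻¹ • u) = (1 / 2 : ℝ) • u := by
    rw [smul_smul]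
    congr 1
    field_simp
  rw [stereoInv, smul_sub, h, smul_smul, add_sub_cancel, thalesPt]
  congr 1
  field_simp

/-- The Carleman change of variables for a function `F (v' - v, vs - v)`. -/
theorem lintegral_sphere_eq_lintegral_orthogonal {m : ℕ} (hm : 1 ≤ m)
    {F : En (m + 1) × En (m + 1) → ℝ≥0∞} (hF : Measurable F) :
    ∫⁻ u : En (m + 1), ∫⁻ σ in Metric.sphere (0 : En (m + 1)) 1,
        F ((1 / 2 : ℝ) • u + (‖u‖ / 2) • σ, u) ∂μH[m] =
      ∫⁻ x : En (m + 1), ENNReal.ofReal (2 ^ m / ‖x‖) * ∫⁻ w in {w : En (m + 1) | ⟪w, x⟫ = 0},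
        F (x, x + w) * ENNReal.ofReal (‖x + w‖ ^ (1 - m : ℝ)) ∂μH[m] := by
  set Q : En (m + 1) × En (m + 1) → ℝ≥0∞ := fun p =>
    ENNReal.ofReal (2 ^ m / ‖p.1‖) * (F p * ENNReal.ofReal (‖p.2‖ ^ (1 - m : ℝ))) with hQ
  have hQm : Measurable Q := by fun_prop
  have hR : ∀ᵐ x : En (m + 1), ENNReal.ofReal (2 ^ m / ‖x‖) *
      ∫⁻ w in {w : En (m + 1) | ⟪w, x⟫ = 0},
        F (x, x + w) * ENNReal.ofReal (‖x + w‖ ^ (1 - m : ℝ)) ∂μH[m] =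
      hausdorffConst m * ∫⁻ t, Q (x, x + perpIso x t) := by
    filter_upwards [Measure.ae_ne volume (0 : En (m + 1))] with x hx
    rw [setLIntegral_hausdorffMeasure_orthogonal hx
      (fun w => F (x, x + w) * ENNReal.ofReal (‖x + w‖ ^ (1 - m : ℝ)))]
    simp only [hQ]
    rw [lintegral_const_mul' _ _ ENNReal.ofReal_ne_top]
    ring
  have hL : ∀ᵐ u : En (m + 1), ∫⁻ σ in Metric.sphere (0 : En (m + 1)) 1,
        F ((1 / 2 : ℝ) • u + (‖u‖ / 2) • σ, u) ∂μH[m] =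
      hausdorffConst m * ∫⁻ t : En m,
        ENNReal.ofReal ((√(1 + ‖t‖ ^ 2))⁻¹ * (‖u‖ / (1 + ‖t‖ ^ 2)) ^ m) *
          Q (thalesPt u t, u) := by
    filter_upwards [Measure.ae_ne volume (0 : En (m + 1))] with u hu
    rw [setLIntegral_sphere_eq_stereoInv hm hu
      (φ := fun σ => F ((1 / 2 : ℝ) • u + (‖u‖ / 2) • σ, u)) (by fun_prop)]
    congr 1
    refine lintegral_congr fun t => ?_
    have hu0 : 0 < ‖u‖ := norm_pos_iff.2 hu
    have h3 : 0 < √(1 + ‖t‖ ^ 2) := by positivity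
    rw [smul_add_smul_stereoInv hu, hQ]
    simp only [norm_thalesPt hu]
    rw [mul_comm (F _) (ENNReal.ofReal _), ← mul_assoc, ← mul_assoc,
      ← ENNReal.ofReal_mul (by positivity), ← ENNReal.ofReal_mul (by positivity),
      ← ENNReal.ofReal_pow (by positivity), Real.rpow_sub hu0, Real.rpow_one, Real.rpow_natCast,
      div_pow, div_pow]
    congr 2
    field_simp
  rw [lintegral_congr_ae hR, lintegral_congr_ae hL,
    lintegral_const_mul' _ _ ENNReal.coe_ne_top, lintegral_const_mul' _ _ ENNReal.coe_ne_top,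
    lintegral_perpIso_eq_lintegral_thalesPt hQm]

/-- identity \eqref{eq:Nfg-energy} of the paper, Carleman reparametrization:
`N_f(g) = ∫∫ (g(v)-g(v'))² K_f(v,v') dv' dv` as an identity in `[0,∞]`. -/
theorem stmt11 (n : ℕ) (hn : 2 ≤ n) (B : ℝ → ℝ → ℝ≥0∞)
    (hB : Measurable (Function.uncurry B)) (f g : En n → ℝ)
    (hf : Measurable f) (hg : Measurable g) (hf0 : ∀ v, 0 ≤ f v) :
    Nfg n B f g =
      ∫⁻ v : En n, ∫⁻ v' : En n,
        ENNReal.ofReal ((g v - g v') ^ 2) * KfCarleman n B f v v' := by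
  obtain ⟨m, rfl⟩ : ∃ m, n = m + 1 := ⟨n - 1, by omega⟩
  have hm : 1 ≤ m := by omega
  have hdim : ((m + 1 : ℕ) : ℝ) - 1 = m := by push_cast; ring
  have hexp : -((m + 1 : ℕ) : ℝ) + 2 = 1 - m := by push_cast; ring
  unfold Nfg
  refine lintegral_congr fun v => ?_
  set F : En (m + 1) × En (m + 1) → ℝ≥0∞ := fun p =>
    ENNReal.ofReal ((g v - g (v + p.1)) ^ 2) * ENNReal.ofReal (f (v + p.2)) *
      Function.uncurry B (‖p.2‖, ⟪‖p.2‖⁻¹ • (-p.2), ‖p.2‖⁻¹ • ((2 : ℝ) • p.1 - p.2)⟫) with hF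
  have hFm : Measurable F := by fun_prop
  have key := lintegral_sphere_eq_lintegral_orthogonal hm hFm
  rw [← lintegral_add_left_eq_self (fun vs => ∫⁻ σ in Metric.sphere (0 : En (m + 1)) 1,
      ENNReal.ofReal ((g v - g ((1/2 : ℝ) • (v + vs) + (‖v - vs‖ / 2) • σ)) ^ 2) *
        ENNReal.ofReal (f vs) * B ‖v - vs‖ ⟪‖v - vs‖⁻¹ • (v - vs), σ⟫ ∂μH[((m + 1 : ℕ):ℝ) - 1]) v,
    ← lintegral_add_left_eq_self (fun v' => ENNReal.ofReal ((g v - g v') ^ 2) *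
      KfCarleman (m + 1) B f v v') v]
  simp only [KfCarleman, hdim, hexp]
  refine Eq.trans (lintegral_congr_ae ?_) (key.trans (lintegral_congr fun x => ?_))
  · filter_upwards [Measure.ae_ne volume (0 : En (m + 1))] with u hu
    have hu0 : ‖u‖ ≠ 0 := norm_ne_zero_iff.2 hu
    refine lintegral_congr fun σ => ?_
    have h1 : v - (v + u) = -u := by abel
    have h2 : (1 / 2 : ℝ) • (v + (v + u)) + (‖u‖ / 2) • σ =
        v + ((1 / 2 : ℝ) • u + (‖u‖ / 2) • σ) := by module
    have h3 : ‖u‖⁻¹ • ((2 : ℝ) • ((1 / 2 : ℝ) • u + (‖u‖ / 2) • σ) - u) = σ := by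
      have : (2 : ℝ) • ((1 / 2 : ℝ) • u + (‖u‖ / 2) • σ) - u = ‖u‖ • σ := by module
      rw [this, smul_smul, inv_mul_cancel₀ hu0, one_smul]
    simp only [hF, h1, norm_neg, h2, h3, Function.uncurry_apply_pair]
  · have h1 : v - (v + x) = -x := by abel
    have h2 : v + x - v = x := by abel
    rw [h1, h2, norm_neg, Nat.add_sub_cancel,
      mul_left_comm (ENNReal.ofReal ((g v - g (v + x)) ^ 2))]
    congr 1
    rw [← lintegral_const_mul' _ _ ENNReal.ofReal_ne_top]
    have hcl : IsClosed {w : En (m + 1) | ⟪w, x⟫ = 0} :=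
      isClosed_eq (by fun_prop) continuous_const
    refine setLIntegral_congr_fun hcl.measurableSet fun w hw => ?_
    have hwx : ⟪x, w⟫ = 0 := by rw [real_inner_comm]; exact hw
    have h3 : √(‖x‖ ^ 2 + ‖w‖ ^ 2) = ‖x + w‖ := by
      rw [← Real.sqrt_sq (norm_nonneg (x + w)), norm_add_sq_real, hwx]
      simp
    have h4 : ‖w - x‖ = ‖x + w‖ := by
      rw [← sq_eq_sq₀ (norm_nonneg _) (norm_nonneg _), norm_add_sq_real, norm_sub_sq_real, hwx,
        real_inner_comm, hwx]
      ring
    have h5 : w - -x = x + w := by abel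
    have h6 : (2 : ℝ) • x - (x + w) = -(w - x) := by module
    have h7 : v + x + w = v + (x + w) := by abel
    simp only [hF, h3, h5, h4, h6, h7, smul_neg, inner_neg_neg, Function.uncurry_apply_pair]
    ring
end
end
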